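/- arXiv:2101.03455 — 2 statements merged into one kernel-verified Lean document; each statement's English description precedes it below -/
import Mathlib

section
/- Let r^E be an anonymous recursive tournament rule with a matching elimination rule, let T be an independent probabilistic tournament on n teams, let u, v be two teams, and condition on the sampled first-round matches M ← E(n) containing the match (u,v). Let w denote the winner of the (u,v) match (a random variable determined by sampling T). Then the gauntlet G^{r^E}_w(T|_M) of the winner in the surviving subtournament is independent of the random variable w; equivalently, for every possible value g of the gauntlet, Pr[G^{r^E}_w(T|_M) = g | w = u] = Pr[G^{r^E}_w(T|_M) = g | w = v]. -/
open scoped Classical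
open Finset

/-! ## Basic tournament notions -/

/-- The set of potential matches among `n` teams: ordered pairs `(i, j)` with `i < j`. -/
abbrev MatchPair (n : ℕ) := {q : Fin n × Fin n // q.1 < q.2}

/-- A deterministic (round robin) tournament on `n` teams: for each pair `i < j`,
`true` means that `i` beats `j`. -/
abbrev Outcome (n : ℕ) := MatchPair n → Bool

/-- `Outcome.beats o i j` holds when team `i` beats team `j` (it is `false` when `i = j`). -/
def Outcome.beats {n : ℕ} (o : Outcome n) (i j : Fin n) : Bool :=
  if h : i < j then o ⟨(i, j), h⟩
  else if h' : j < i then !o ⟨(j, i), h'⟩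
  else false

/-- An independent probabilistic tournament on `n` teams: `p i j` is the probability
that `i` beats `j`, with `p i j + p j i = 1` for `i ≠ j`. -/
structure ProbTournament (n : ℕ) where
  p : Fin n → Fin n → ℝ
  mem_Icc : ∀ i j : Fin n, p i j ∈ Set.Icc (0 : ℝ) 1
  compl : ∀ i j : Fin n, i ≠ j → p i j + p j i = 1

/-- The probability of the deterministic outcome `o` when all matches are independent
with probabilities given by `T`. -/
noncomputable def ProbTournament.prob {n : ℕ} (T : ProbTournament n) (o : Outcome n) : ℝ :=
  ∏ e : MatchPair n, (if o e then T.p e.val.1 e.val.2 else T.p e.val.2 e.val.1)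

/-- `rP r T i`: the probability that team `i` wins when rule `r` is applied to the
independent probabilistic tournament `T`. -/
noncomputable def rP (r : ∀ n : ℕ, Outcome n → Fin n → ℝ) {n : ℕ}
    (T : ProbTournament n) (i : Fin n) : ℝ :=
  ∑ o : Outcome n, T.prob o * r n o i

/-- `rPS r T S`: the probability that the winner lies in `S`. -/
noncomputable def rPS (r : ∀ n : ℕ, Outcome n → Fin n → ℝ) {n : ℕ}
    (T : ProbTournament n) (S : Finset (Fin n)) : ℝ :=
  ∑ i ∈ S, rP r T i

/-- A tournament rule assigns a probability distribution over the teams to every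
deterministic tournament. -/
def IsTournamentRule (r : ∀ n : ℕ, Outcome n → Fin n → ℝ) : Prop :=
  (∀ (n : ℕ) (o : Outcome n) (i : Fin n), 0 ≤ r n o i) ∧
  (∀ n : ℕ, 0 < n → ∀ o : Outcome n, ∑ i : Fin n, r n o i = 1)

/-- A rule is Condorcet-consistent if an undefeated team wins with probability 1. -/
def CondorcetConsistent (r : ∀ n : ℕ, Outcome n → Fin n → ℝ) : Prop :=
  ∀ (n : ℕ) (o : Outcome n) (i : Fin n),
    (∀ j : Fin n, j ≠ i → Outcome.beats o i j = true) → r n o i = 1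

/-- Two independent probabilistic tournaments are `S`-adjacent if they agree on every
match that is not between two members of `S`. -/
def Adjacent {n : ℕ} (S : Finset (Fin n)) (T T' : ProbTournament n) : Prop :=
  ∀ i j : Fin n, ¬(i ∈ S ∧ j ∈ S) → T.p i j = T'.p i j

/-- Weakly ε-bounded: all match probabilities lie in `[1/2 - ε, 1/2 + ε]`. -/
def WeaklyBounded (ε : ℝ) (n : ℕ) (T : ProbTournament n) : Prop :=
  ∀ i j : Fin n, i ≠ j → T.p i j ∈ Set.Icc (1/2 - ε) (1/2 + ε)

/-- Strictly ε-bounded: all match probabilities lie in `{1/2 - ε, 1/2 + ε}`. -/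
def StrictlyBounded (ε : ℝ) (n : ℕ) (T : ProbTournament n) : Prop :=
  ∀ i j : Fin n, i ≠ j → T.p i j = 1/2 - ε ∨ T.p i j = 1/2 + ε

/-- `alph r k C`: the manipulability `α_k^r(C)`, i.e. the supremum over tournaments in the
class `C` (on any number of teams), sets `S` of at most `k` teams, and `S`-adjacent
manipulations `T'`, of the gain `r_S(T') - r_S(T)`. -/
noncomputable def alph (r : ∀ n : ℕ, Outcome n → Fin n → ℝ) (k : ℕ)
    (C : ∀ n : ℕ, ProbTournament n → Prop) : ℝ :=
  sSup {x : ℝ | ∃ (n : ℕ) (T T' : ProbTournament n) (S : Finset (Fin n)),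
    C n T ∧ S.card ≤ k ∧ Adjacent S T T' ∧ x = rPS r T' S - rPS r T S}

/-! ## Anonymity -/

/-- The relabeling of an outcome by a permutation `σ`: in `permOutcome σ o`,
team `σ i` beats team `σ j` exactly when `i` beats `j` in `o`. -/
def permOutcome {n : ℕ} (σ : Equiv.Perm (Fin n)) (o : Outcome n) : Outcome n :=
  fun e => Outcome.beats o (σ.symm e.val.1) (σ.symm e.val.2)

/-- A tournament rule is anonymous if relabeling the teams relabels the winner
distribution accordingly. -/
def IsAnonymous (r : ∀ n : ℕ, Outcome n → Fin n → ℝ) : Prop :=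
  ∀ (n : ℕ) (σ : Equiv.Perm (Fin n)) (o : Outcome n) (i : Fin n),
    r n (permOutcome σ o) (σ i) = r n o i

/-! ## Elimination rules and recursive tournament rules -/

/-- An elimination rule: for every number `n > 1` of teams, a distribution `d n` over
sets `M` of matches to be played, with `1 ≤ |M| ≤ n - 1` on the support. -/
structure ElimRule where
  d : ∀ n : ℕ, Finset (MatchPair n) → ℝ
  nonneg : ∀ (n : ℕ) (M : Finset (MatchPair n)), 0 ≤ d n M
  sum_one : ∀ n : ℕ, 1 < n → ∑ M : Finset (MatchPair n), d n M = 1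
  supp : ∀ (n : ℕ) (M : Finset (MatchPair n)), 1 < n → d n M ≠ 0 →
    1 ≤ M.card ∧ M.card ≤ n - 1

/-- A set of matches is a matching when no team appears in two distinct matches. -/
def IsMatchingSet {n : ℕ} (M : Finset (MatchPair n)) : Prop :=
  ∀ e ∈ M, ∀ e' ∈ M, e ≠ e' →
    e.val.1 ≠ e'.val.1 ∧ e.val.1 ≠ e'.val.2 ∧ e.val.2 ≠ e'.val.1 ∧ e.val.2 ≠ e'.val.2

/-- A matching elimination rule only ever selects matchings. -/
def ElimRule.IsMatchingRule (E : ElimRule) : Prop :=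
  ∀ (n : ℕ) (M : Finset (MatchPair n)), E.d n M ≠ 0 → IsMatchingSet M

/-- Team `i` loses one of the matches in `M` under the outcome `o`. -/
def losesIn {n : ℕ} (o : Outcome n) (M : Finset (MatchPair n)) (i : Fin n) : Prop :=
  ∃ e ∈ M, (e.val.1 = i ∧ Outcome.beats o e.val.2 i = true) ∨
           (e.val.2 = i ∧ Outcome.beats o e.val.1 i = true)

/-- The teams surviving the matches `M` (i.e. not losing any match of `M`). -/
noncomputable def survivors {n : ℕ} (o : Outcome n) (M : Finset (MatchPair n)) :
    Finset (Fin n) :=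
  Finset.univ.filter (fun i => ¬ losesIn o M i)

/-- The induced sub-outcome on the teams of `s`, reindexed by `Fin s.card` in
increasing order. -/
noncomputable def restrictOutcome {n : ℕ} (o : Outcome n) (s : Finset (Fin n)) :
    Outcome s.card :=
  fun e => Outcome.beats o (↑(s.orderIsoOfFin rfl e.val.1)) (↑(s.orderIsoOfFin rfl e.val.2))

/-- The induced probabilistic subtournament on the teams of `s` (same match
probabilities), reindexed by `Fin s.card` in increasing order. -/
noncomputable def restrictProb {n : ℕ} (T : ProbTournament n) (s : Finset (Fin n)) :
    ProbTournament s.card where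
  p a b := T.p ↑(s.orderIsoOfFin rfl a) ↑(s.orderIsoOfFin rfl b)
  mem_Icc _ _ := T.mem_Icc _ _
  compl a b hab := T.compl _ _
    (fun h => hab ((s.orderIsoOfFin rfl).injective (Subtype.coe_injective h)))

/-- The subset of `Fin s.card` corresponding to the members of `S` that lie in `s`. -/
noncomputable def mapTeams {n : ℕ} (s : Finset (Fin n)) (S : Finset (Fin n)) :
    Finset (Fin s.card) :=
  Finset.univ.filter (fun a => (↑(s.orderIsoOfFin rfl a) : Fin n) ∈ S)

/-- Fueled recursion computing the winner distribution of the recursive tournament rule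
`r^E`: sample `M ← E(n)`, eliminate all losers of matches in `M`, recurse on survivors. -/
noncomputable def recWinAux (E : ElimRule) : ℕ → ∀ n : ℕ, Outcome n → Fin n → ℝ
  | 0, n, _, _ => if n = 1 then 1 else 0
  | fuel + 1, n, o, i =>
    if n ≤ 1 then (if n = 1 then 1 else 0)
    else ∑ M : Finset (MatchPair n), E.d n M *
      (if h : i ∈ survivors o M then
        recWinAux E fuel (survivors o M).card (restrictOutcome o (survivors o M))
          (((survivors o M).orderIsoOfFin rfl).symm ⟨i, h⟩)
      else 0)

/-- The recursive tournament rule `r^E` determined by the elimination rule `E`. -/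
noncomputable def recWin (E : ElimRule) : ∀ n : ℕ, Outcome n → Fin n → ℝ :=
  fun n => recWinAux E n n

/-- `matchMem M u v`: the match between `u` and `v` belongs to `M`. -/
def matchMem {n : ℕ} (M : Finset (MatchPair n)) (u v : Fin n) : Prop :=
  ∃ e ∈ M, e.val = (u, v) ∨ e.val = (v, u)

/-- `valAfter r T M S`: the expected probability that the winner lies in `S` when the
matches in `M` are played with outcomes drawn from `T`, the losers are eliminated, and
`r` is then run on the induced probabilistic subtournament `T|_M` of the survivors
(with the convention that eliminated teams win with probability `0`). -/
noncomputable def valAfter (r : ∀ n : ℕ, Outcome n → Fin n → ℝ) {n : ℕ}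
    (T : ProbTournament n) (M : Finset (MatchPair n)) (S : Finset (Fin n)) : ℝ :=
  ∑ o : Outcome n, T.prob o *
    rPS r (restrictProb T (survivors o M)) (mapTeams (survivors o M) S)

/-- `U` is a base case for the manipulating coalition `S` under rule `r`:
no `S`-adjacent manipulation gains anything, i.e. `α_S^r(U) = 0`. -/
def IsBaseCase (r : ∀ n : ℕ, Outcome n → Fin n → ℝ) {m : ℕ}
    (U : ProbTournament m) (S : Finset (Fin m)) : Prop :=
  ∀ U' : ProbTournament m, Adjacent S U U' → rPS r U' S - rPS r U S ≤ 0

/-! ## Gauntlets -/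

/-- The tournament obtained from `o` by letting `u` beat every other team, keeping all
other matches intact. -/
def condorcetify {n : ℕ} (o : Outcome n) (u : Fin n) : Outcome n :=
  fun e => if e.val.1 = u then true else if e.val.2 = u then false else o e

/-- The opponents of `u` among the matches in `M`. -/
noncomputable def opponents {n : ℕ} (M : Finset (MatchPair n)) (u : Fin n) :
    Finset (Fin n) :=
  (M.filter (fun e => e.val.1 = u)).image (fun e => e.val.2) ∪
  (M.filter (fun e => e.val.2 = u)).image (fun e => e.val.1)

/-- Fueled recursion for the distribution of the gauntlet of `u`: the set of opponents
that `u` plays in elimination matches when `r^E` is executed on a tournament in which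
`u` beats everybody (the input `o` is assumed already so modified).  The value is the
probability, over the internal randomness of `E`, that the gauntlet equals `g`
(recorded as a set of teams of the outermost tournament). -/
noncomputable def gauntletDistAux (E : ElimRule) :
    ℕ → ∀ n : ℕ, Outcome n → Fin n → Finset (Fin n) → ℝ
  | 0, _, _, _, g => if g = ∅ then 1 else 0
  | fuel + 1, n, o, u, g =>
    if n ≤ 1 then (if g = ∅ then 1 else 0)
    else ∑ M : Finset (MatchPair n), E.d n M *
      (if h : u ∈ survivors o M ∧ opponents M u ⊆ g ∧ g \ opponents M u ⊆ survivors o M then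
        gauntletDistAux E fuel (survivors o M).card (restrictOutcome o (survivors o M))
          (((survivors o M).orderIsoOfFin rfl).symm ⟨u, h.1⟩)
          (Finset.univ.filter (fun a =>
            (↑((survivors o M).orderIsoOfFin rfl a) : Fin n) ∈ g \ opponents M u))
      else 0)

/-- `gauntletDist E n o u g`: the probability that the gauntlet `G^{r^E}_u(o)` of team
`u` in the deterministic tournament `o` equals the set `g`. -/
noncomputable def gauntletDist (E : ElimRule) (n : ℕ) (o : Outcome n) (u : Fin n)
    (g : Finset (Fin n)) : ℝ :=
  gauntletDistAux E n n (condorcetify o u) u g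

/-- `gauntletProbP E T u g`: the probability that the gauntlet `G^{r^E}_u(T)` of team `u`
in the independent probabilistic tournament `T` equals the set `g` (first sampling a
deterministic tournament from `T`, then the gauntlet). -/
noncomputable def gauntletProbP (E : ElimRule) {n : ℕ} (T : ProbTournament n)
    (u : Fin n) (g : Finset (Fin n)) : ℝ :=
  ∑ o : Outcome n, T.prob o * gauntletDist E n o u g

/-- Given the first-round outcome `o` and matches `M`, the probability that the gauntlet
of team `x` in the surviving probabilistic subtournament `T|_M` equals the set `g`
(where `g` is recorded with the original team labels). -/
noncomputable def gauntletEventProb (E : ElimRule) {n : ℕ} (T : ProbTournament n)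
    (M : Finset (MatchPair n)) (x : Fin n) (g : Finset (Fin n)) (o : Outcome n) : ℝ :=
  if h : x ∈ survivors o M ∧ g ⊆ survivors o M then
    gauntletProbP E (restrictProb T (survivors o M))
      (((survivors o M).orderIsoOfFin rfl).symm ⟨x, h.1⟩)
      (Finset.univ.filter (fun a =>
        (↑((survivors o M).orderIsoOfFin rfl a) : Fin n) ∈ g))
  else 0

/-! ## Randomized Death Match -/

/-- Fueled recursion for Randomized Death Match: pick one of the `n.choose 2` matches
uniformly at random, eliminate the loser, recurse. -/
noncomputable def RDMAux : ℕ → ∀ n : ℕ, Outcome n → Fin n → ℝ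
  | 0, n, _, _ => if n = 1 then 1 else 0
  | fuel + 1, n, o, i =>
    if n ≤ 1 then (if n = 1 then 1 else 0)
    else ((n.choose 2 : ℝ))⁻¹ * ∑ e : MatchPair n,
      (if h : i ∈ survivors o {e} then
        RDMAux fuel (survivors o {e}).card (restrictOutcome o (survivors o {e}))
          (((survivors o {e}).orderIsoOfFin rfl).symm ⟨i, h⟩)
      else 0)

/-- Randomized Death Match. -/
noncomputable def RDM : ∀ n : ℕ, Outcome n → Fin n → ℝ :=
  fun n => RDMAux n n

/-! ## Randomized Single Elimination Bracket -/

/-- `nextPow2 n = 2 ^ ⌈log₂ n⌉`. -/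
def nextPow2 (n : ℕ) : ℕ := 2 ^ Nat.clog 2 n

/-- Extend a tournament on `n` teams to `nextPow2 n` teams by adding dummy teams that
lose to all original teams (among themselves, the dummy with lower index wins). -/
def extendOutcome {n : ℕ} (o : Outcome n) : Outcome (nextPow2 n) :=
  fun e =>
    if h : (e.val.2 : ℕ) < n then
      Outcome.beats o ⟨(e.val.1 : ℕ), lt_trans (Fin.lt_def.mp e.2) h⟩ ⟨(e.val.2 : ℕ), h⟩
    else true

/-- Fueled recursion for Randomized Single Elimination Bracket (after dummies have been
added): pick a uniformly random maximum matching on the remaining teams, play those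
matches, eliminate all losers, recurse. -/
noncomputable def RSEBAux : ℕ → ∀ n : ℕ, Outcome n → Fin n → ℝ
  | 0, n, _, _ => if n = 1 then 1 else 0
  | fuel + 1, n, o, i =>
    if n ≤ 1 then (if n = 1 then 1 else 0)
    else
      ((Finset.univ.filter
          (fun M : Finset (MatchPair n) => IsMatchingSet M ∧ M.card = n / 2)).card : ℝ)⁻¹ *
        ∑ M ∈ Finset.univ.filter
            (fun M : Finset (MatchPair n) => IsMatchingSet M ∧ M.card = n / 2),
          (if h : i ∈ survivors o M then
            RSEBAux fuel (survivors o M).card (restrictOutcome o (survivors o M))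
              (((survivors o M).orderIsoOfFin rfl).symm ⟨i, h⟩)
          else 0)

/-- Randomized Single Elimination Bracket. -/
noncomputable def RSEB : ∀ n : ℕ, Outcome n → Fin n → ℝ :=
  fun n o i =>
    RSEBAux (nextPow2 n) (nextPow2 n) (extendOutcome o)
      (Fin.castLE (Nat.le_pow_clog one_lt_two n) i)

/-! ## Statement -/

set_option linter.unusedVariables false

lemma beats_comm {n : ℕ} (o : Outcome n) {i j : Fin n} (h : i ≠ j) :
    Outcome.beats o j i = !Outcome.beats o i j := by
  unfold Outcome.beats
  rcases lt_or_gt_of_ne h with h1 | h1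
  · simp [h1, not_lt_of_gt h1]
  · simp [h1, not_lt_of_gt h1]

lemma beats_self {n : ℕ} (o : Outcome n) (i : Fin n) : Outcome.beats o i i = false := by
  simp [Outcome.beats]

lemma beats_pair {n : ℕ} (o : Outcome n) (e : MatchPair n) :
    Outcome.beats o e.val.1 e.val.2 = o e := by
  simp [Outcome.beats, e.2]

/-- Outcomes from an antisymmetric function. -/
lemma beats_mk {n : ℕ} (F : Fin n → Fin n → Bool) (hF : ∀ i j, i ≠ j → F j i = !F i j)
    {i j : Fin n} (h : i ≠ j) :
    Outcome.beats (fun e : MatchPair n => F e.val.1 e.val.2) i j = F i j := by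
  unfold Outcome.beats
  rcases lt_or_gt_of_ne h with h1 | h1
  · simp [h1]
  · simp [h1, not_lt_of_gt h1, hF i j h]

lemma outcome_ext {n : ℕ} {o o' : Outcome n}
    (h : ∀ i j, i ≠ j → Outcome.beats o i j = Outcome.beats o' i j) : o = o' := by
  funext e
  rw [← beats_pair o, ← beats_pair o']
  exact h _ _ (ne_of_lt e.2)

lemma beats_perm {n : ℕ} (σ : Equiv.Perm (Fin n)) (o : Outcome n) {i j : Fin n} (h : i ≠ j) :
    Outcome.beats (permOutcome σ o) i j = Outcome.beats o (σ.symm i) (σ.symm j) :=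
  beats_mk (fun i j => Outcome.beats o (σ.symm i) (σ.symm j))
    (fun i j hij => beats_comm o (fun h => hij (σ.symm.injective h))) h

lemma beats_restrict {n : ℕ} (o : Outcome n) (s : Finset (Fin n)) {i j : Fin s.card}
    (h : i ≠ j) :
    Outcome.beats (restrictOutcome o s) i j =
      Outcome.beats o (s.orderIsoOfFin rfl i) (s.orderIsoOfFin rfl j) :=
  beats_mk (fun i j => Outcome.beats o (s.orderIsoOfFin rfl i) (s.orderIsoOfFin rfl j))
    (fun i j hij => beats_comm o
      (fun h => hij ((s.orderIsoOfFin rfl).injective (Subtype.coe_injective h)))) h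

lemma beats_condorcetify {n : ℕ} (o : Outcome n) (u : Fin n) {i j : Fin n} (h : i ≠ j) :
    Outcome.beats (condorcetify o u) i j =
      if i = u then true else if j = u then false else Outcome.beats o i j := by
  unfold Outcome.beats condorcetify
  rcases lt_or_gt_of_ne h with h1 | h1
  · simp [h1]
  · simp only [not_lt_of_gt h1, h1, dif_neg, dif_pos, not_false_eq_true]
    split_ifs <;> simp_all

lemma mem_opponents {n : ℕ} (M : Finset (MatchPair n)) (u j : Fin n) :
    j ∈ opponents M u ↔ ∃ e ∈ M, (e.val.1 = u ∧ e.val.2 = j) ∨ (e.val.2 = u ∧ e.val.1 = j) := by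
  simp only [opponents, mem_union, mem_image, mem_filter]
  constructor
  · rintro (⟨e, ⟨h1, h2⟩, h3⟩ | ⟨e, ⟨h1, h2⟩, h3⟩)
    · exact ⟨e, h1, Or.inl ⟨h2, h3⟩⟩
    · exact ⟨e, h1, Or.inr ⟨h2, h3⟩⟩
  · rintro ⟨e, h1, (⟨h2, h3⟩ | ⟨h2, h3⟩)⟩
    · exact Or.inl ⟨e, ⟨h1, h2⟩, h3⟩
    · exact Or.inr ⟨e, ⟨h1, h2⟩, h3⟩

lemma opponents_symm {n : ℕ} {M : Finset (MatchPair n)} {u j : Fin n}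
    (h : j ∈ opponents M u) : u ∈ opponents M j := by
  rw [mem_opponents] at *
  obtain ⟨e, h1, h2⟩ := h
  exact ⟨e, h1, by tauto⟩

lemma opponents_ne {n : ℕ} {M : Finset (MatchPair n)} {u j : Fin n}
    (h : j ∈ opponents M u) : j ≠ u := by
  rw [mem_opponents] at h
  obtain ⟨e, h1, h2⟩ := h
  have := ne_of_lt e.2
  rcases h2 with ⟨rfl, rfl⟩ | ⟨rfl, rfl⟩
  · exact this.symm
  · exact this

lemma mem_survivors {n : ℕ} (o : Outcome n) (M : Finset (MatchPair n)) (i : Fin n) :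
    i ∈ survivors o M ↔ ∀ j ∈ opponents M i, Outcome.beats o i j = true := by
  have : losesIn o M i ↔ ∃ j ∈ opponents M i, Outcome.beats o j i = true := by
    simp only [losesIn, mem_opponents]
    constructor
    · rintro ⟨e, h1, (⟨h2, h3⟩ | ⟨h2, h3⟩)⟩
      · exact ⟨_, ⟨e, h1, Or.inl ⟨h2, rfl⟩⟩, h3⟩
      · exact ⟨_, ⟨e, h1, Or.inr ⟨h2, rfl⟩⟩, h3⟩
    · rintro ⟨j, ⟨e, h1, (⟨h2, rfl⟩ | ⟨h2, rfl⟩)⟩, h3⟩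
      · exact ⟨e, h1, Or.inl ⟨h2, h3⟩⟩
      · exact ⟨e, h1, Or.inr ⟨h2, h3⟩⟩
  simp only [survivors, mem_filter, mem_univ, true_and, this, not_exists, not_and]
  refine forall₂_congr fun j hj => ?_
  rw [beats_comm o (opponents_ne hj).symm]
  simp

lemma survivors_card_lt {n : ℕ} (o : Outcome n) (M : Finset (MatchPair n)) (hM : 1 ≤ M.card) :
    (survivors o M).card < n := by
  obtain ⟨e, he⟩ := Finset.card_pos.mp hM
  have hne := ne_of_lt e.2
  have h1 : e.val.2 ∈ opponents M e.val.1 := (mem_opponents _ _ _).2 ⟨e, he, Or.inl ⟨rfl, rfl⟩⟩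
  have : ∃ x, x ∉ survivors o M := by
    by_contra hcon
    push Not at hcon
    have a := (mem_survivors _ _ _).1 (hcon e.val.1) _ h1
    have b := (mem_survivors _ _ _).1 (hcon e.val.2) _ (opponents_symm h1)
    rw [beats_comm o hne, a] at b
    simp at b
  obtain ⟨x, hx⟩ := this
  simpa using Finset.card_lt_univ_of_notMem hx

lemma mem_survivors_condorcetify {n : ℕ} (o : Outcome n) (M : Finset (MatchPair n)) (i : Fin n) :
    i ∈ survivors (condorcetify o i) M := by
  rw [mem_survivors]
  intro j hj
  rw [beats_condorcetify _ _ (opponents_ne hj).symm]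
  simp

lemma survivors_condorcetify {n : ℕ} (o : Outcome n) (M : Finset (MatchPair n)) (i : Fin n)
    (hi : i ∈ survivors o M) : survivors (condorcetify o i) M = survivors o M := by
  ext k
  by_cases hk : k = i
  · subst hk
    simp [hi, mem_survivors_condorcetify]
  rw [mem_survivors, mem_survivors]
  refine forall₂_congr fun j hj => ?_
  rw [beats_condorcetify _ _ (opponents_ne hj).symm, if_neg hk]
  split_ifs with h
  · subst h
    have := (mem_survivors _ _ _).1 hi k (opponents_symm hj)
    rw [beats_comm o (Ne.symm hk), this]
    simp
  · rfl

lemma restrict_condorcetify {n : ℕ} (o : Outcome n) (s : Finset (Fin n)) (i : Fin n)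
    (hi : i ∈ s) : restrictOutcome (condorcetify o i) s =
      condorcetify (restrictOutcome o s) ((s.orderIsoOfFin rfl).symm ⟨i, hi⟩) := by
  have key : ∀ a : Fin s.card, a = (s.orderIsoOfFin rfl).symm ⟨i, hi⟩ ↔
      (s.orderIsoOfFin rfl a : Fin n) = i := by
    intro a
    rw [← OrderIso.symm_apply_eq, OrderIso.symm_symm, Subtype.ext_iff]
  apply outcome_ext
  intro a b hab
  have hab' : (s.orderIsoOfFin rfl a : Fin n) ≠ s.orderIsoOfFin rfl b :=
    fun h => hab ((s.orderIsoOfFin rfl).injective (Subtype.coe_injective h))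
  rw [beats_restrict _ _ hab, beats_condorcetify _ _ hab', beats_condorcetify _ _ hab,
    beats_restrict _ _ hab]
  simp only [key]

/-- The set of teams beaten by `i`. -/
noncomputable def beatSet {n : ℕ} (o : Outcome n) (i : Fin n) : Finset (Fin n) :=
  Finset.univ.filter (fun j => Outcome.beats o i j = true)

/-- One step of the gauntlet recursion, with the survivor set as a parameter. -/
noncomputable def gaStep (E : ElimRule) (f : ℕ) {n : ℕ} (o : Outcome n)
    (M : Finset (MatchPair n)) (s : Finset (Fin n)) (u : Fin n) (g : Finset (Fin n)) : ℝ :=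
  if h : u ∈ s ∧ opponents M u ⊆ g ∧ g \ opponents M u ⊆ s then
    gauntletDistAux E f s.card (restrictOutcome o s) ((s.orderIsoOfFin rfl).symm ⟨u, h.1⟩)
      (Finset.univ.filter (fun a => (↑(s.orderIsoOfFin rfl a) : Fin n) ∈ g \ opponents M u))
  else 0

/-- One step of the winner recursion, with the survivor set as a parameter. -/
noncomputable def rwStep (E : ElimRule) (f : ℕ) {n : ℕ} (o : Outcome n)
    (s : Finset (Fin n)) (u : Fin n) : ℝ :=
  if h : u ∈ s then
    recWinAux E f s.card (restrictOutcome o s) ((s.orderIsoOfFin rfl).symm ⟨u, h⟩)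
  else 0

/-- The gauntlet event, with the survivor set as a parameter. -/
noncomputable def geStep (E : ElimRule) {n : ℕ} (T : ProbTournament n)
    (s : Finset (Fin n)) (x : Fin n) (g : Finset (Fin n)) : ℝ :=
  if h : x ∈ s ∧ g ⊆ s then
    gauntletProbP E (restrictProb T s) ((s.orderIsoOfFin rfl).symm ⟨x, h.1⟩)
      (Finset.univ.filter (fun a => (↑(s.orderIsoOfFin rfl a) : Fin n) ∈ g))
  else 0

lemma recWinAux_eq (E : ElimRule) : ∀ (f n : ℕ) (o : Outcome n) (i : Fin n), n ≤ f →
    recWinAux E f n o i =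
      ∑ g ∈ (beatSet o i).powerset, gauntletDistAux E f n (condorcetify o i) i g := by
  intro f
  induction f with
  | zero =>
    intro n o i hn
    have := i.pos
    omega
  | succ f ih =>
    intro n o i hn
    have hpos := i.pos
    by_cases h1 : n ≤ 1
    · have hn1 : n = 1 := by omega
      simp [recWinAux, gauntletDistAux, hn1]
    simp only [recWinAux, gauntletDistAux, if_neg h1]
    rw [Finset.sum_comm]
    refine Finset.sum_congr rfl fun M _ => ?_
    rw [← Finset.mul_sum]
    by_cases hd : E.d n M = 0
    · simp [hd]
    congr 1
    have hcard := survivors_card_lt o M (E.supp n M (by omega) hd).1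
    change rwStep E f o (survivors o M) i = ∑ g ∈ (beatSet o i).powerset,
      gaStep E f (condorcetify o i) M (survivors (condorcetify o i) M) i g
    by_cases hi : i ∈ survivors o M
    · rw [survivors_condorcetify o M i hi]
      have hopp := (mem_survivors _ _ _).1 hi
      generalize hs : survivors o M = s at *
      unfold rwStep gaStep
      rw [dif_pos hi, ih _ _ _ (by omega), restrict_condorcetify o _ i hi]
      have hdisj : ∀ j ∈ opponents M i, j ∉ s := by
        intro j hj hjs
        rw [← hs] at hjs
        have := (mem_survivors _ _ _).1 hjs i (opponents_symm hj)
        rw [beats_comm o (opponents_ne hj).symm, hopp j hj] at this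
        simp at this
      have emb : Function.Injective (fun a : Fin s.card => (s.orderIsoOfFin rfl a : Fin n)) :=
        fun a b h => (s.orderIsoOfFin rfl).injective (Subtype.coe_injective h)
      have hback : ∀ g' : Finset (Fin s.card),
          Finset.univ.filter (fun a : Fin s.card => (s.orderIsoOfFin rfl a : Fin n) ∈
            (g'.image (fun a : Fin s.card => (s.orderIsoOfFin rfl a : Fin n)) ∪ opponents M i) \
              opponents M i) = g' := by
        intro g'
        ext a
        have h2 : (s.orderIsoOfFin rfl a : Fin n) ∉ opponents M i :=
          fun h => hdisj _ h (s.orderIsoOfFin rfl a).2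
        simp only [mem_filter, mem_univ, true_and, mem_sdiff, mem_union, h2, or_false,
          not_false_eq_true, and_true]
        exact emb.mem_finset_image
      have hbeat : ∀ a : Fin s.card, a ∈ beatSet (restrictOutcome o s)
          ((s.orderIsoOfFin rfl).symm ⟨i, hi⟩) ↔ (s.orderIsoOfFin rfl a : Fin n) ∈ beatSet o i := by
        intro a
        simp only [beatSet, mem_filter, mem_univ, true_and]
        by_cases ha : (s.orderIsoOfFin rfl).symm ⟨i, hi⟩ = a
        · subst ha
          simp [beats_self]
        · rw [beats_restrict _ _ ha]
          simp
      refine Finset.sum_of_injOn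
        (fun g' => g'.image (fun a : Fin s.card => (s.orderIsoOfFin rfl a : Fin n)) ∪
          opponents M i) ?_ ?_ ?_ ?_
      · intro g1 _ g2 _ h
        rw [← hback g1, ← hback g2]
        simp only at h
        rw [h]
      · intro g' hg'
        simp only [Finset.mem_coe, Finset.mem_powerset] at hg' ⊢
        apply Finset.union_subset
        · intro x hx
          obtain ⟨a, ha, rfl⟩ := Finset.mem_image.1 hx
          exact (hbeat a).1 (hg' ha)
        · intro j hj
          simp [beatSet, hopp j hj]
      · intro g hg hng
        apply dif_neg
        rintro ⟨-, h2, h3⟩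
        apply hng
        refine ⟨Finset.univ.filter (fun a : Fin s.card => (s.orderIsoOfFin rfl a : Fin n) ∈
            g \ opponents M i), ?_, ?_⟩
        · simp only [Finset.mem_coe, Finset.mem_powerset] at hg ⊢
          intro a ha
          exact (hbeat a).2 (hg (Finset.mem_sdiff.1 (Finset.mem_filter.1 ha).2).1)
        · ext x
          simp only [mem_union, mem_image, mem_filter, mem_univ, true_and]
          constructor
          · rintro (⟨a, ha, rfl⟩ | hx)
            · exact (Finset.mem_sdiff.1 ha).1
            · exact h2 hx
          · intro hx
            by_cases hxo : x ∈ opponents M i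
            · exact Or.inr hxo
            · left
              have hx' := Finset.mem_sdiff.2 ⟨hx, hxo⟩
              exact ⟨(s.orderIsoOfFin rfl).symm ⟨x, h3 hx'⟩, by simpa using ⟨hx, hxo⟩, by simp⟩
      · intro g' hg'
        rw [dif_pos, hback]
        refine ⟨hi, Finset.subset_union_right, ?_⟩
        intro x hx
        obtain ⟨hx1, hx2⟩ := Finset.mem_sdiff.1 hx
        obtain h | h := Finset.mem_union.1 hx1
        · obtain ⟨a, ha, rfl⟩ := Finset.mem_image.1 h
          exact (s.orderIsoOfFin rfl a).2
        · exact absurd h hx2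
    · rw [rwStep, dif_neg hi]
      symm
      apply Finset.sum_eq_zero
      intro g hg
      apply dif_neg
      rintro ⟨-, h2, -⟩
      apply hi
      rw [mem_survivors]
      intro j hj
      have := (Finset.mem_powerset.1 hg) (h2 hj)
      simpa [beatSet] using this

lemma gauntletDistAux_self (E : ElimRule) : ∀ (f n : ℕ) (o : Outcome n) (i : Fin n)
    (g : Finset (Fin n)), i ∈ g → gauntletDistAux E f n o i g = 0 := by
  intro f
  induction f with
  | zero =>
    intro n o i g hg
    have : g ≠ ∅ := Finset.ne_empty_of_mem hg
    simp [gauntletDistAux, this]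
  | succ f ih =>
    intro n o i g hg
    have : g ≠ ∅ := Finset.ne_empty_of_mem hg
    simp only [gauntletDistAux, if_neg this]
    split_ifs
    · rfl
    apply Finset.sum_eq_zero
    intro M _
    split_ifs with h
    · rw [ih, mul_zero]
      simp only [mem_filter, mem_univ, true_and, OrderIso.apply_symm_apply, mem_sdiff]
      exact ⟨hg, fun h => opponents_ne h rfl⟩
    · simp

/-- Make `i` beat exactly the teams in `W`. -/
noncomputable def setBeats {n : ℕ} (o : Outcome n) (i : Fin n) (W : Finset (Fin n)) : Outcome n :=
  fun e => (fun a b => if a = i then decide (b ∈ W) else if b = i then !decide (a ∈ W) else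
    Outcome.beats o a b) e.val.1 e.val.2

lemma beats_setBeats {n : ℕ} (o : Outcome n) (i : Fin n) (W : Finset (Fin n)) {a b : Fin n}
    (h : a ≠ b) : Outcome.beats (setBeats o i W) a b =
      if a = i then decide (b ∈ W) else if b = i then !decide (a ∈ W) else
      Outcome.beats o a b := by
  refine beats_mk (fun a b => if a = i then decide (b ∈ W) else
    if b = i then !decide (a ∈ W) else Outcome.beats o a b) ?_ h
  intro a b hab
  have := beats_comm o hab
  by_cases ha : a = i <;> by_cases hb : b = i
  · exact absurd (ha.trans hb.symm) hab
  all_goals simp [ha, hb, this]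

lemma recWin_setBeats (E : ElimRule) {n : ℕ} (o : Outcome n) (i : Fin n) (W : Finset (Fin n))
    (hW : i ∉ W) : recWin E n (setBeats o i W) i = ∑ g ∈ W.powerset, gauntletDist E n o i g := by
  have h1 : beatSet (setBeats o i W) i = W := by
    ext j
    by_cases hj : i = j
    · subst hj
      simp [beatSet, beats_self, hW]
    · simp [beatSet, beats_setBeats o i W hj]
  have h2 : condorcetify (setBeats o i W) i = condorcetify o i := by
    apply outcome_ext
    intro a b hab
    rw [beats_condorcetify _ _ hab, beats_condorcetify _ _ hab, beats_setBeats _ _ _ hab]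
    split_ifs <;> rfl
  rw [recWin, recWinAux_eq E n n _ _ le_rfl, h1, h2]
  rfl

lemma perm_setBeats {n : ℕ} (σ : Equiv.Perm (Fin n)) (o : Outcome n) (i : Fin n)
    (W : Finset (Fin n)) : permOutcome σ (setBeats o i W) =
      setBeats (permOutcome σ o) (σ i) (W.map σ.toEmbedding) := by
  apply outcome_ext
  intro a b hab
  have hab' : σ.symm a ≠ σ.symm b := fun h => hab (σ.symm.injective h)
  rw [beats_perm _ _ hab, beats_setBeats _ _ _ hab', beats_setBeats _ _ _ hab, beats_perm _ _ hab]
  simp only [Equiv.symm_apply_eq, Finset.mem_map_equiv]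

lemma gauntletDist_perm (E : ElimRule) (hanon : IsAnonymous (recWin E)) {n : ℕ}
    (σ : Equiv.Perm (Fin n)) (o : Outcome n) (i : Fin n) : ∀ g : Finset (Fin n), i ∉ g →
    gauntletDist E n (permOutcome σ o) (σ i) (g.map σ.toEmbedding) = gauntletDist E n o i g := by
  intro g
  induction g using Finset.strongInduction with
  | H g ih =>
    intro hg
    have h1 := recWin_setBeats E o i g hg
    have h2 := recWin_setBeats E (permOutcome σ o) (σ i) (g.map σ.toEmbedding) (by simpa using hg)
    rw [← perm_setBeats, hanon, h1] at h2
    have h3 : (g.map σ.toEmbedding).powerset =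
        g.powerset.map (Finset.mapEmbedding σ.toEmbedding).toEmbedding := by
      ext x
      simp only [mem_powerset, mem_map]
      constructor
      · intro hx
        refine ⟨x.map σ.symm.toEmbedding, ?_, ?_⟩
        · intro y hy
          have hy2 := Finset.mem_map_equiv.1 hy
          have := hx hy2
          simpa using this
        · ext y
          simp [Finset.mapEmbedding_apply]
      · rintro ⟨y, hy, rfl⟩
        exact Finset.map_subset_map.2 hy
    rw [h3, Finset.sum_map] at h2
    have hmem : g ∈ g.powerset := Finset.mem_powerset_self g
    rw [← Finset.add_sum_erase _ _ hmem, ← Finset.add_sum_erase _ _ hmem] at h2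
    have h4 : ∑ x ∈ g.powerset.erase g, gauntletDist E n o i x =
        ∑ x ∈ g.powerset.erase g, gauntletDist E n (permOutcome σ o) (σ i)
          ((Finset.mapEmbedding σ.toEmbedding).toEmbedding x) := by
      refine Finset.sum_congr rfl fun x hx => ?_
      rw [Finset.mem_erase, Finset.mem_powerset] at hx
      exact (ih x (Finset.ssubset_iff_subset_ne.2 ⟨hx.2, hx.1⟩) (fun h => hg (hx.2 h))).symm
    rw [h4] at h2
    exact (add_right_cancel h2).symm

/-- Flip the result of match `e`. -/
noncomputable def flipAt {n : ℕ} (e : MatchPair n) (o : Outcome n) : Outcome n :=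
  Function.update o e (!o e)

lemma flipAt_invol {n : ℕ} (e : MatchPair n) : Function.Involutive (flipAt e) := by
  intro o
  simp [flipAt]

/-- Weight of one match. -/
noncomputable def wt {n : ℕ} (T : ProbTournament n) (e : MatchPair n) (b : Bool) : ℝ :=
  if b then T.p e.val.1 e.val.2 else T.p e.val.2 e.val.1

lemma prod_flip {ι : Type*} [Fintype ι] [DecidableEq ι] (w : ι → Bool → ℝ) (a : ι) (o : ι → Bool) (b : Bool) :
    ∏ e, w e (Function.update o a b e) = w a b * ∏ e ∈ Finset.univ.erase a, w e (o e) := by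
  rw [← Finset.mul_prod_erase _ _ (Finset.mem_univ a)]
  congr 1
  · simp
  · refine Finset.prod_congr rfl fun e he => ?_
    rw [Function.update_of_ne (Finset.ne_of_mem_erase he)]

lemma sum_weight_congr {n : ℕ} (f : Outcome n → ℝ) (A : Finset (MatchPair n)) :
    ∀ (w w' : MatchPair n → Bool → ℝ), (∀ e, w e true + w e false = 1) →
    (∀ e, w' e true + w' e false = 1) → (∀ e, e ∉ A → w e = w' e) →
    (∀ e ∈ A, ∀ o, f (flipAt e o) = f o) →
    ∑ o : Outcome n, (∏ e, w e (o e)) * f o = ∑ o : Outcome n, (∏ e, w' e (o e)) * f o := by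
  induction A using Finset.induction_on with
  | empty =>
    intro w w' _ _ h _
    have : w = w' := funext fun e => h e (by simp)
    rw [this]
  | insert a A ha ih =>
    intro w w' hw hw' hag hf
    trans ∑ o : Outcome n, (∏ e, (Function.update w a (w' a)) e (o e)) * f o
    · have step : ∀ w : MatchPair n → Bool → ℝ, (∀ e, w e true + w e false = 1) →
          2 * ∑ o : Outcome n, (∏ e, w e (o e)) * f o =
            ∑ o : Outcome n, (∏ e ∈ Finset.univ.erase a, w e (o e)) * f o := by
        intro w hw
        have hfl : ∑ o : Outcome n, (∏ e, w e (o e)) * f o =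
            ∑ o : Outcome n, (∏ e, w e (flipAt a o e)) * f (flipAt a o) :=
          (Equiv.sum_comp (flipAt_invol a).toPerm
            (fun o : Outcome n => (∏ e, w e (o e)) * f o)).symm
        rw [two_mul]
        nth_rewrite 2 [hfl]
        rw [← Finset.sum_add_distrib]
        refine Finset.sum_congr rfl fun o _ => ?_
        rw [hf a (Finset.mem_insert_self _ _), ← add_mul]
        congr 1
        have e1 := prod_flip w a o (o a)
        rw [Function.update_eq_self] at e1
        rw [e1, flipAt, prod_flip w a o, ← add_mul]
        have : w a (o a) + w a (!o a) = 1 := by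
          have := hw a
          cases o a
          · simpa [add_comm] using this
          · simpa using this
        rw [this, one_mul]
      have s1 := step w hw
      have s2 := step (Function.update w a (w' a)) (by
        intro e
        by_cases h : e = a
        · subst h
          simpa using hw' e
        · simpa [Function.update_of_ne h] using hw e)
      have s3 : ∀ o : Outcome n, ∏ e ∈ Finset.univ.erase a, (Function.update w a (w' a)) e (o e) =
          ∏ e ∈ Finset.univ.erase a, w e (o e) := by
        intro o
        refine Finset.prod_congr rfl fun e he => ?_
        rw [Function.update_of_ne (Finset.ne_of_mem_erase he)]
      simp only [s3] at s2
      linarith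
    · apply ih
      · intro e
        by_cases h : e = a
        · subst h
          simpa using hw' e
        · simpa [Function.update_of_ne h] using hw e
      · exact hw'
      · intro e he
        by_cases h : e = a
        · subst h
          simp
        · rw [Function.update_of_ne h]
          exact hag e (by simp [h, he])
      · intro e he
        exact hf e (Finset.mem_insert_of_mem he)

lemma condorcetify_flip {n : ℕ} (o : Outcome n) (u : Fin n) (e : MatchPair n)
    (he : e.val.1 = u ∨ e.val.2 = u) : condorcetify (flipAt e o) u = condorcetify o u := by
  funext e'
  unfold condorcetify flipAt
  by_cases h : e' = e
  · subst h
    rcases he with he | he <;> simp [he]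
  · rw [Function.update_of_ne h]

lemma gauntletProbP_congr (E : ElimRule) {n : ℕ} (T T' : ProbTournament n) (u : Fin n)
    (g : Finset (Fin n)) (h : ∀ a b, a ≠ u → b ≠ u → T.p a b = T'.p a b) :
    gauntletProbP E T u g = gauntletProbP E T' u g := by
  have hw : ∀ T : ProbTournament n, ∀ e, wt T e true + wt T e false = 1 := by
    intro T e
    simpa [wt] using T.compl _ _ (ne_of_lt e.2)
  refine sum_weight_congr (fun o => gauntletDist E n o u g)
    (Finset.univ.filter (fun e : MatchPair n => e.val.1 = u ∨ e.val.2 = u)) (wt T) (wt T')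
    (hw T) (hw T') ?_ ?_
  · intro e he
    simp only [mem_filter, mem_univ, true_and, not_or] at he
    funext b
    simp [wt, h _ _ he.1 he.2, h _ _ he.2 he.1]
  · intro e he o
    simp only [mem_filter, mem_univ, true_and] at he
    simp only [gauntletDist, condorcetify_flip o u e he]

/-- Relabel a pair. -/
def pairMap {n : ℕ} (σ : Equiv.Perm (Fin n)) (e : MatchPair n) : MatchPair n :=
  if h : σ e.val.1 < σ e.val.2 then ⟨(σ e.val.1, σ e.val.2), h⟩
  else ⟨(σ e.val.2, σ e.val.1), lt_of_le_of_ne (not_lt.1 h)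
    (fun h' => ne_of_lt e.2 (σ.injective h').symm)⟩

lemma pairMap_cases {n : ℕ} (σ : Equiv.Perm (Fin n)) (e : MatchPair n) :
    (pairMap σ e).val = (σ e.val.1, σ e.val.2) ∨ (pairMap σ e).val = (σ e.val.2, σ e.val.1) := by
  unfold pairMap
  split_ifs <;> simp

lemma pairMap_bij {n : ℕ} (σ : Equiv.Perm (Fin n)) : Function.Bijective (pairMap σ) := by
  apply Finite.injective_iff_bijective.1
  intro e e' h
  have h1 := pairMap_cases σ e
  have h2 := pairMap_cases σ e'
  rw [h] at h1
  have l1 := e.2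
  have l2 := e'.2
  apply Subtype.ext
  rcases h1 with h1 | h1 <;> rcases h2 with h2 | h2 <;> rw [h1, Prod.mk.injEq] at h2 <;>
    obtain ⟨h3, h4⟩ := h2 <;> have h3 := σ.injective h3 <;> have h4 := σ.injective h4
  · exact Prod.ext h3 h4
  · rw [h3, h4] at l1
    exact absurd l1 (not_lt_of_gt l2)
  · rw [h3, h4] at l1
    exact absurd l1 (not_lt_of_gt l2)
  · exact Prod.ext h4 h3

lemma prod_pairs_perm {n : ℕ} (σ : Equiv.Perm (Fin n)) (F : Fin n → Fin n → ℝ)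
    (hF : ∀ a b, a ≠ b → F a b = F b a) :
    ∏ e : MatchPair n, F e.val.1 e.val.2 = ∏ e : MatchPair n, F (σ e.val.1) (σ e.val.2) := by
  rw [← Function.Bijective.prod_comp (pairMap_bij σ)]
  refine Finset.prod_congr rfl fun e _ => ?_
  rcases pairMap_cases σ e with h | h
  · rw [h]
  · rw [h]
    exact hF _ _ (fun h' => ne_of_lt e.2 (σ.injective h').symm)

/-- Pull back a probabilistic tournament. -/
def pullProb {n : ℕ} (σ : Equiv.Perm (Fin n)) (T : ProbTournament n) : ProbTournament n where
  p a b := T.p (σ a) (σ b)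
  mem_Icc _ _ := T.mem_Icc _ _
  compl _ _ hab := T.compl _ _ (fun h => hab (σ.injective h))

lemma prob_eq {n : ℕ} (T : ProbTournament n) (o : Outcome n) :
    T.prob o = ∏ e : MatchPair n, (fun a b => if Outcome.beats o a b then T.p a b else T.p b a)
      e.val.1 e.val.2 := by
  unfold ProbTournament.prob
  refine Finset.prod_congr rfl fun e _ => ?_
  simp only [beats_pair]

lemma prob_perm {n : ℕ} (σ : Equiv.Perm (Fin n)) (T : ProbTournament n) (o : Outcome n) :
    T.prob (permOutcome σ o) = (pullProb σ T).prob o := by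
  rw [prob_eq, prob_eq, prod_pairs_perm σ
    (fun a b => if Outcome.beats (permOutcome σ o) a b then T.p a b else T.p b a)]
  · refine Finset.prod_congr rfl fun e _ => ?_
    have hne : σ e.val.1 ≠ σ e.val.2 := fun h => ne_of_lt e.2 (σ.injective h)
    simp only [beats_perm σ o hne, Equiv.symm_apply_apply, pullProb]
  · intro a b hab
    simp only [beats_comm _ hab]
    cases Outcome.beats (permOutcome σ o) a b <;> simp

lemma permOutcome_bij {n : ℕ} (σ : Equiv.Perm (Fin n)) :
    Function.Bijective (permOutcome σ : Outcome n → Outcome n) := by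
  apply Finite.injective_iff_bijective.1
  intro o o' h
  apply outcome_ext
  intro i j hij
  have hne : σ i ≠ σ j := fun h => hij (σ.injective h)
  have h1 := beats_perm σ o hne
  have h2 := beats_perm σ o' hne
  rw [h] at h1
  simpa using h1.symm.trans h2

lemma gauntletProbP_equiv (E : ElimRule) (hanon : IsAnonymous (recWin E)) {n n' : ℕ}
    (σ : Fin n ≃ Fin n') (T : ProbTournament n) (T' : ProbTournament n') (u : Fin n)
    (g : Finset (Fin n)) (hug : u ∉ g)
    (h : ∀ a b, a ≠ u → b ≠ u → T.p a b = T'.p (σ a) (σ b)) :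
    gauntletProbP E T u g = gauntletProbP E T' (σ u) (g.map σ.toEmbedding) := by
  obtain rfl : n = n' := by simpa using Fintype.card_congr σ
  rw [gauntletProbP_congr E T (pullProb σ T') u g h]
  unfold gauntletProbP
  rw [← Function.Bijective.sum_comp (permOutcome_bij σ)
    (fun o => T'.prob o * gauntletDist E n o (σ u) (g.map σ.toEmbedding))]
  refine Finset.sum_congr rfl fun o _ => ?_
  simp only [prob_perm, gauntletDist_perm E hanon σ o u g hug]

lemma beats_flip_other {n : ℕ} (o : Outcome n) (e : MatchPair n) {a b : Fin n}
    (h1 : e.val ≠ (a, b)) (h2 : e.val ≠ (b, a)) :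
    Outcome.beats (flipAt e o) a b = Outcome.beats o a b := by
  unfold Outcome.beats flipAt
  split_ifs with h h'
  · rw [Function.update_of_ne]
    intro hh
    exact h1 (by rw [← hh])
  · rw [Function.update_of_ne]
    intro hh
    exact h2 (by rw [← hh])
  · rfl

lemma beats_flip_self {n : ℕ} (o : Outcome n) (e : MatchPair n) {a b : Fin n}
    (h : e.val = (a, b) ∨ e.val = (b, a)) :
    Outcome.beats (flipAt e o) a b = !Outcome.beats o a b := by
  obtain ⟨⟨x, y⟩, hxy⟩ := e
  rcases h with h | h
  · simp only [Prod.mk.injEq] at h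
    obtain ⟨rfl, rfl⟩ := h
    have hxy' : x < y := hxy
    simp [Outcome.beats, hxy', flipAt]
  · simp only [Prod.mk.injEq] at h
    obtain ⟨rfl, rfl⟩ := h
    have hxy' : x < y := hxy
    simp [Outcome.beats, hxy', not_lt_of_gt hxy', flipAt]

lemma opponents_matched {n : ℕ} {M : Finset (MatchPair n)} (hMM : IsMatchingSet M)
    {e : MatchPair n} (he : e ∈ M) {u v : Fin n} (h : e.val = (u, v) ∨ e.val = (v, u)) :
    opponents M u = {v} := by
  ext j
  rw [mem_opponents, Finset.mem_singleton]
  constructor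
  · rintro ⟨e', he', h'⟩
    by_cases hee : e = e'
    · subst hee
      have hne := ne_of_lt e.2
      rcases h with h | h <;> rcases h' with ⟨h1, h2⟩ | ⟨h1, h2⟩ <;> simp_all
    · have := hMM e he e' he' hee
      rcases h with h | h <;> rcases h' with ⟨h1, h2⟩ | ⟨h1, h2⟩ <;> simp_all
  · rintro rfl
    refine ⟨e, he, ?_⟩
    rcases h with h | h <;> simp [h]

/-- The core symmetry: swapping the winner of `(u, v)`. -/
lemma event_swap (E : ElimRule) (hanon : IsAnonymous (recWin E)) {n : ℕ} (T : ProbTournament n)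
    (u v : Fin n) (huv : u ≠ v) (M : Finset (MatchPair n)) (g : Finset (Fin n))
    (hMM : IsMatchingSet M) (e : MatchPair n) (he : e ∈ M)
    (hev : e.val = (u, v) ∨ e.val = (v, u)) (o : Outcome n) (ho : Outcome.beats o u v = true) :
    gauntletEventProb E T M u g o = gauntletEventProb E T M v g (flipAt e o) := by
  have hou : opponents M u = {v} := opponents_matched hMM he hev
  have hov : opponents M v = {u} := opponents_matched hMM he hev.symm
  have ho' : Outcome.beats (flipAt e o) v u = true := by
    rw [beats_flip_self o e hev.symm, beats_comm o huv, ho]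
    rfl
  have us : u ∈ survivors o M := by
    rw [mem_survivors, hou]
    simpa using ho
  have vs : v ∉ survivors o M := by
    rw [mem_survivors, hov]
    simp [beats_comm o huv, ho]
  have vs' : v ∈ survivors (flipAt e o) M := by
    rw [mem_survivors, hov]
    simpa using ho'
  have us' : u ∉ survivors (flipAt e o) M := by
    rw [mem_survivors, hou]
    simp [beats_comm _ huv.symm, ho']
  have other : ∀ x, x ≠ u → x ≠ v → (x ∈ survivors o M ↔ x ∈ survivors (flipAt e o) M) := by
    intro x hxu hxv
    rw [mem_survivors, mem_survivors]
    refine forall₂_congr fun j _ => ?_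
    rw [beats_flip_other]
    · rcases hev with h | h <;> rw [h] <;> simp [hxu.symm, hxv.symm]
    · rcases hev with h | h <;> rw [h] <;> simp [hxu.symm, hxv.symm]
  change geStep E T (survivors o M) u g = geStep E T (survivors (flipAt e o) M) v g
  generalize survivors o M = s at *
  generalize survivors (flipAt e o) M = s' at *
  unfold geStep
  by_cases hug : u ∈ g
  · rw [dif_neg (c := v ∈ s' ∧ g ⊆ s') (fun h => us' (h.2 hug))]
    split_ifs
    · unfold gauntletProbP gauntletDist
      apply Finset.sum_eq_zero
      intro o _
      rw [gauntletDistAux_self, mul_zero]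
      simp only [mem_filter, mem_univ, true_and, OrderIso.apply_symm_apply]
      exact hug
    · rfl
  by_cases hvg : v ∈ g
  · rw [dif_neg (c := u ∈ s ∧ g ⊆ s) (fun h => vs (h.2 hvg))]
    symm
    split_ifs
    · unfold gauntletProbP gauntletDist
      apply Finset.sum_eq_zero
      intro o _
      rw [gauntletDistAux_self, mul_zero]
      simp only [mem_filter, mem_univ, true_and, OrderIso.apply_symm_apply]
      exact hvg
    · rfl
  have hgs : g ⊆ s ↔ g ⊆ s' := by
    refine forall₂_congr fun x hx => ?_
    exact other x (fun h => hug (h ▸ hx)) (fun h => hvg (h ▸ hx))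
  by_cases hg : g ⊆ s
  · rw [dif_pos ⟨us, hg⟩, dif_pos ⟨vs', hgs.1 hg⟩]
    have hsw : ∀ x, x ∈ s ↔ Equiv.swap u v x ∈ s' := by
      intro x
      by_cases hxu : x = u
      · subst hxu
        simp [us, vs']
      by_cases hxv : x = v
      · subst hxv
        simp [vs, us']
      rw [Equiv.swap_apply_of_ne_of_ne hxu hxv]
      exact other x hxu hxv
    let σ : Fin s.card ≃ Fin s'.card :=
      ((s.orderIsoOfFin rfl).toEquiv.trans ((Equiv.swap u v).subtypeEquiv hsw)).trans
        (s'.orderIsoOfFin rfl).symm.toEquiv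
    have hσ : ∀ a, (s'.orderIsoOfFin rfl (σ a) : Fin n) =
        Equiv.swap u v (s.orderIsoOfFin rfl a : Fin n) := by
      intro a
      simp [σ]
    have hav : ∀ a, (s.orderIsoOfFin rfl a : Fin n) ≠ v :=
      fun a h => vs (h ▸ (s.orderIsoOfFin rfl a).2)
    have hσu : σ ((s.orderIsoOfFin rfl).symm ⟨u, us⟩) = (s'.orderIsoOfFin rfl).symm ⟨v, vs'⟩ := by
      apply (s'.orderIsoOfFin rfl).injective
      apply Subtype.ext
      rw [hσ]
      simp
    have hne : ∀ a, a ≠ (s.orderIsoOfFin rfl).symm ⟨u, us⟩ →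
        (s.orderIsoOfFin rfl a : Fin n) ≠ u := by
      intro a ha h
      apply ha
      apply (s.orderIsoOfFin rfl).injective
      apply Subtype.ext
      simpa using h
    rw [gauntletProbP_equiv E hanon σ (restrictProb T s) (restrictProb T s'), hσu]
    · congr 1
      ext b
      rw [Finset.mem_map_equiv]
      obtain ⟨a, rfl⟩ := σ.surjective b
      simp only [Equiv.symm_apply_apply, mem_filter, mem_univ, true_and, hσ]
      by_cases ha : (s.orderIsoOfFin rfl a : Fin n) = u
      · rw [ha]
        simp [hug, hvg]
      · rw [Equiv.swap_apply_of_ne_of_ne ha (hav a)]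
    · simp only [mem_filter, mem_univ, true_and, OrderIso.apply_symm_apply]
      exact hug
    · intro a b ha hb
      simp only [restrictProb, hσ]
      rw [Equiv.swap_apply_of_ne_of_ne (hne a ha) (hav a),
        Equiv.swap_apply_of_ne_of_ne (hne b hb) (hav b)]
  · rw [dif_neg (fun h => hg h.2), dif_neg (fun h => hg (hgs.2 h.2))]

lemma prob_flip {n : ℕ} (T : ProbTournament n) (e : MatchPair n) (o : Outcome n) (b : Bool) :
    T.prob (Function.update o e b) =
      wt T e b * ∏ e' ∈ Finset.univ.erase e, wt T e' (o e') :=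
  prod_flip (wt T) e o b

theorem stmt7 (E : ElimRule) (hmatch : E.IsMatchingRule)
    (hanon : IsAnonymous (recWin E)) {n : ℕ} (T : ProbTournament n)
    (u v : Fin n) (huv : u ≠ v) (M : Finset (MatchPair n))
    (hM : matchMem M u v) (hd : E.d n M ≠ 0) (g : Finset (Fin n)) :
    (∑ o : Outcome n, T.prob o *
        (if Outcome.beats o u v then gauntletEventProb E T M u g o else 0)) * T.p v u
    = (∑ o : Outcome n, T.prob o *
        (if Outcome.beats o v u then gauntletEventProb E T M v g o else 0)) * T.p u v := by
  obtain ⟨e, he, hev⟩ := hM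
  have hMM := hmatch n M hd
  rw [Finset.sum_mul, Finset.sum_mul]
  rw [← Equiv.sum_comp (flipAt_invol e).toPerm (fun o : Outcome n => T.prob o *
        (if Outcome.beats o v u then gauntletEventProb E T M v g o else 0) * T.p u v)]
  refine Finset.sum_congr rfl fun o _ => ?_
  change T.prob o * (if Outcome.beats o u v then gauntletEventProb E T M u g o else 0) * T.p v u =
    T.prob (flipAt e o) * (if Outcome.beats (flipAt e o) v u then
      gauntletEventProb E T M v g (flipAt e o) else 0) * T.p u v
  have hb : Outcome.beats (flipAt e o) v u = Outcome.beats o u v := by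
    rw [beats_flip_self o e hev.symm, beats_comm o huv]
    simp
  rw [hb]
  by_cases ho : Outcome.beats o u v = true
  · rw [if_pos ho, if_pos ho, ← event_swap E hanon T u v huv M g hMM e he hev o ho]
    have key : T.prob o * T.p v u = T.prob (flipAt e o) * T.p u v := by
      have h1 := prob_flip T e o (o e)
      rw [Function.update_eq_self] at h1
      rw [h1, flipAt, prob_flip]
      have hoe := beats_pair o e
      rcases hev with h | h
      · rw [h] at hoe
        simp only at hoe
        rw [ho] at hoe
        rw [← hoe]
        simp only [wt, h]
        simp
        ring
      · rw [h] at hoe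
        simp only at hoe
        rw [beats_comm o huv, ho] at hoe
        rw [← hoe]
        simp only [wt, h]
        simp
        ring
    linear_combination gauntletEventProb E T M u g o * key
  · rw [if_neg ho, if_neg ho]
    simp
end

section
/- For every ε ∈ [0,1/2], Randomized Death Match satisfies α₂^{RDM}(𝒯^ε) = ε/3 + 2ε²/3. In particular, for every weakly ε-bounded independent probabilistic tournament T, every pair of teams S = {u,v}, and every T' that is S-adjacent to T, RDM_S(T') − RDM_S(T) ≤ ε/3 + 2ε²/3, and the supremum of such gains over all T ∈ 𝒯^ε, pairs S, and S-adjacent T' equals ε/3 + 2ε²/3. -/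
open scoped Classical
open Finset

/-! ## Abstract recursions -/

namespace RDMProof

variable {n : ℕ}

/-- Total weight with which `x` is eliminated by other members of `L`. -/
def qs (p : Fin n → Fin n → ℝ) (L : Finset (Fin n)) (x : Fin n) : ℝ :=
  ∑ y ∈ L.erase x, p y x

/-- Winning probability of a distinguished team against the field `L`. -/
noncomputable def Wf (p : Fin n → Fin n → ℝ) (a : Fin n → ℝ) : ℕ → Finset (Fin n) → ℝ
  | 0, _ => 1
  | k+1, L => (((k+2).choose 2 : ℕ) : ℝ)⁻¹ *
      ∑ x ∈ L, (a x + qs p L x) * Wf p a k (L.erase x)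

/-- Normalised gain of the pair of manipulators against the field `L`. -/
noncomputable def Gf (p : Fin n → Fin n → ℝ) (a b : Fin n → ℝ) : ℕ → Finset (Fin n) → ℝ
  | 0, _ => 0
  | k+1, L => (((k+3).choose 2 : ℕ) : ℝ)⁻¹ *
      (∑ x ∈ L, (a x + b x + qs p L x) * Gf p a b k (L.erase x)
        + (Wf p a (k+1) L - Wf p b (k+1) L))

theorem choose2_succ (k : ℕ) : (((k+1).choose 2 : ℕ) : ℝ) = k + ((k.choose 2 : ℕ) : ℝ) := by
  rw [Nat.choose_succ_succ' k 1]; simp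

theorem choose2_pos (k : ℕ) : (0 : ℝ) < (((k+2).choose 2 : ℕ) : ℝ) := by
  exact_mod_cast Nat.choose_pos (by omega)

theorem Gf_antisymm (p : Fin n → Fin n → ℝ) (a b : Fin n → ℝ) (k : ℕ) :
    ∀ L, Gf p a b k L = - Gf p b a k L := by
  induction k with
  | zero => intro L; simp [Gf]
  | succ k ih =>
    intro L
    simp only [Gf]
    rw [← mul_neg, neg_add, ← Finset.sum_neg_distrib]
    congr 2
    · apply Finset.sum_congr rfl
      intro x _
      rw [ih]; ring
    · ring

theorem qs_nonneg {p : Fin n → Fin n → ℝ} (hp : ∀ i j, 0 ≤ p i j) (L) (x) : 0 ≤ qs p L x :=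
  Finset.sum_nonneg fun _ _ => hp _ _

theorem sum_qs {p : Fin n → Fin n → ℝ} (hc : ∀ i j, i ≠ j → p i j + p j i = 1)
    (L : Finset (Fin n)) : ∑ x ∈ L, qs p L x = ((L.card.choose 2 : ℕ) : ℝ) := by
  induction L using Finset.induction_on with
  | empty => simp
  | insert z L hz ih =>
    rw [Finset.sum_insert hz, Finset.card_insert_of_notMem hz, choose2_succ, ← ih]
    have h1 : qs p (insert z L) z = ∑ y ∈ L, p y z := by
      unfold qs; rw [Finset.erase_insert hz]
    have h2 : ∀ x ∈ L, qs p (insert z L) x = p z x + qs p L x := by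
      intro x hx
      have hne : z ≠ x := fun h => hz (h ▸ hx)
      unfold qs
      rw [Finset.erase_insert_of_ne hne, Finset.sum_insert]
      simp [hz]
    rw [h1, Finset.sum_congr rfl h2, Finset.sum_add_distrib, ← add_assoc,
      ← Finset.sum_add_distrib]
    congr 1
    rw [Finset.sum_congr rfl (g := fun _ => (1:ℝ))]
    · simp
    · intro x hx
      exact hc _ _ (fun h => hz (h ▸ hx))

theorem Wf_nonneg {p : Fin n → Fin n → ℝ} (hp : ∀ i j, 0 ≤ p i j) {a : Fin n → ℝ}
    (ha : ∀ x, 0 ≤ a x) (k : ℕ) : ∀ L, 0 ≤ Wf p a k L := by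
  induction k with
  | zero => intro L; simp [Wf]
  | succ k ih =>
    intro L
    simp only [Wf]
    apply mul_nonneg (inv_nonneg.2 (Nat.cast_nonneg _))
    exact Finset.sum_nonneg fun x _ =>
      mul_nonneg (add_nonneg (ha x) (qs_nonneg hp _ _)) (ih _)

theorem Wf_mono {p : Fin n → Fin n → ℝ} (hp : ∀ i j, 0 ≤ p i j) {a b : Fin n → ℝ}
    (ha : ∀ x, 0 ≤ a x) (hb : ∀ x, 0 ≤ b x) (k : ℕ) :
    ∀ L, (∀ x ∈ L, a x ≤ b x) → Wf p a k L ≤ Wf p b k L := by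
  induction k with
  | zero => intro L _; simp [Wf]
  | succ k ih =>
    intro L hL
    simp only [Wf]
    apply mul_le_mul_of_nonneg_left _ (inv_nonneg.2 (Nat.cast_nonneg _))
    apply Finset.sum_le_sum
    intro x hx
    apply mul_le_mul
    · linarith [hL x hx]
    · exact ih _ fun y hy => hL y (Finset.mem_of_mem_erase hy)
    · exact Wf_nonneg hp ha _ _
    · exact add_nonneg (hb x) (qs_nonneg hp _ _)

theorem pow_diff {h l : ℝ} (hl : 0 ≤ l) (hlh : l ≤ h) (hs : h + l = 1) (i : ℕ) :
    h ^ (i+1) - l ^ (i+1) ≤ h - l := by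
  induction i with
  | zero => simp
  | succ i ih =>
    have e : h ^ (i+1+1) - l ^ (i+1+1)
        = (h ^ (i+1) - l ^ (i+1)) * (h + l) - h * l * (h ^ i - l ^ i) := by ring
    rw [e, hs]
    have : 0 ≤ h * l * (h ^ i - l ^ i) := by
      apply mul_nonneg (mul_nonneg (hl.trans hlh) hl)
      linarith [pow_le_pow_left₀ hl hlh i]
    linarith

theorem Wf_diff {p : Fin n → Fin n → ℝ} (hp : ∀ i j, 0 ≤ p i j)
    (hc : ∀ i j, i ≠ j → p i j + p j i = 1)
    {h l : ℝ} (hl : 0 ≤ l) (hlh : l ≤ h) (hs : h + l = 1) {a b : Fin n → ℝ}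
    (ha : ∀ x, 0 ≤ a x ∧ a x ≤ h) (hb : ∀ x, l ≤ b x) (k : ℕ) :
    ∀ (L : Finset (Fin n)) (i : ℕ), L.card = k →
      h ^ i * Wf p a k L - l ^ i * Wf p b k L ≤ h - l := by
  have hh : 0 ≤ h := hl.trans hlh
  induction k with
  | zero =>
    intro L i _
    simp only [Wf, mul_one]
    cases i with
    | zero => simp; exact hlh
    | succ i => exact pow_diff hl hlh hs i
  | succ k ih =>
    intro L i hL
    simp only [Wf]
    have hpos := choose2_pos k
    have key : h ^ i * ∑ x ∈ L, (a x + qs p L x) * Wf p a k (L.erase x)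
        - l ^ i * ∑ x ∈ L, (b x + qs p L x) * Wf p b k (L.erase x)
        ≤ (((k+2).choose 2 : ℕ) : ℝ) * (h - l) := by
      rw [Finset.mul_sum, Finset.mul_sum, ← Finset.sum_sub_distrib]
      calc _ ≤ ∑ x ∈ L, (1 + qs p L x) * (h - l) := by
            apply Finset.sum_le_sum
            intro x hx
            have hcard : (L.erase x).card = k := by
              rw [Finset.card_erase_of_mem hx, hL]; simp
            have i1 := ih (L.erase x) (i+1) hcard
            have i2 := ih (L.erase x) i hcard
            have q0 := qs_nonneg hp L x
            have w1 := Wf_nonneg hp (fun x => (ha x).1) k (L.erase x)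
            have w2 := Wf_nonneg hp (fun x => hl.trans (hb x)) k (L.erase x)
            have j1 : a x * (h ^ i * Wf p a k (L.erase x))
                ≤ h * (h ^ i * Wf p a k (L.erase x)) :=
              mul_le_mul_of_nonneg_right (ha x).2 (mul_nonneg (pow_nonneg hh _) w1)
            have j2 : l * (l ^ i * Wf p b k (L.erase x))
                ≤ b x * (l ^ i * Wf p b k (L.erase x)) :=
              mul_le_mul_of_nonneg_right (hb x) (mul_nonneg (pow_nonneg hl _) w2)
            have j3 := mul_le_mul_of_nonneg_left i2 q0
            rw [pow_succ, pow_succ] at i1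
            nlinarith
        _ = _ := by
            rw [← Finset.sum_mul, Finset.sum_add_distrib, sum_qs hc, hL,
              choose2_succ (k+1)]
            simp [hL]
    calc _ = (((k+2).choose 2 : ℕ) : ℝ)⁻¹ * (h ^ i * ∑ x ∈ L, (a x + qs p L x) * Wf p a k (L.erase x)
        - l ^ i * ∑ x ∈ L, (b x + qs p L x) * Wf p b k (L.erase x)) := by ring
      _ ≤ (((k+2).choose 2 : ℕ) : ℝ)⁻¹ * ((((k+2).choose 2 : ℕ) : ℝ) * (h - l)) :=
          mul_le_mul_of_nonneg_left key (inv_nonneg.2 hpos.le)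
      _ = h - l := by field_simp

theorem Gf_nonpos {p : Fin n → Fin n → ℝ} (hp : ∀ i j, 0 ≤ p i j) {a b : Fin n → ℝ}
    (ha : ∀ x, 0 ≤ a x) (hb : ∀ x, 0 ≤ b x) (k : ℕ) :
    ∀ L, (∀ x ∈ L, a x ≤ b x) → Gf p a b k L ≤ 0 := by
  induction k with
  | zero => intro L _; simp [Gf]
  | succ k ih =>
    intro L hL
    simp only [Gf]
    apply mul_nonpos_of_nonneg_of_nonpos (inv_nonneg.2 (Nat.cast_nonneg _))
    have h1 := Wf_mono hp ha hb (k+1) L hL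
    have h2 : ∑ x ∈ L, (a x + b x + qs p L x) * Gf p a b k (L.erase x) ≤ 0 := by
      apply Finset.sum_nonpos
      intro x hx
      apply mul_nonpos_of_nonneg_of_nonpos
      · linarith [ha x, hb x, qs_nonneg hp L x]
      · exact ih _ fun y hy => hL y (Finset.mem_of_mem_erase hy)
    linarith

theorem Gf_corner {p : Fin n → Fin n → ℝ} (hp : ∀ i j, 0 ≤ p i j)
    (hc : ∀ i j, i ≠ j → p i j + p j i = 1)
    {h l : ℝ} (hl : 0 ≤ l) (hlh : l ≤ h) (hs : h + l = 1) {a b : Fin n → ℝ}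
    (ha : ∀ x, a x = l ∨ a x = h) (hb : ∀ x, b x = l ∨ b x = h) (k : ℕ) :
    ∀ (L : Finset (Fin n)), L.card = k → Gf p a b k L ≤ (h - l) / 3 := by
  have hh : 0 ≤ h := hl.trans hlh
  have hh1 : h ≤ 1 := by linarith
  have ha' : ∀ x, 0 ≤ a x ∧ a x ≤ h ∧ l ≤ a x := fun x => by
    rcases ha x with e | e <;> rw [e] <;> refine ⟨?_, ?_, ?_⟩ <;> linarith
  have hb' : ∀ x, 0 ≤ b x ∧ b x ≤ h ∧ l ≤ b x := fun x => by
    rcases hb x with e | e <;> rw [e] <;> refine ⟨?_, ?_, ?_⟩ <;> linarith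
  have hP : ∀ x, ¬ a x ≤ b x → a x + b x = 1 := fun x hx => by
    rcases ha x with e | e <;> rcases hb x with e' | e' <;> rw [e, e'] at hx ⊢
    · exact absurd le_rfl hx
    · exact absurd hlh hx
    · exact hs
    · exact absurd le_rfl hx
  induction k with
  | zero => intro L _; simp only [Gf]; linarith
  | succ k ih =>
    intro L hL
    by_cases hJ : ∀ x ∈ L, a x ≤ b x
    · have := Gf_nonpos hp (fun x => (ha' x).1) (fun x => (hb' x).1) (k+1) L hJ
      linarith
    push Not at hJ
    obtain ⟨z, hz, hzab⟩ := hJ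
    have hD := Wf_diff hp hc hl hlh hs (fun x => ⟨(ha' x).1, (ha' x).2.1⟩)
      (fun x => (hb' x).2.2) (k+1) L 0 hL
    simp only [pow_zero, one_mul] at hD
    have hcard : ∀ x ∈ L, (L.erase x).card = k := fun x hx => by
      rw [Finset.card_erase_of_mem hx, hL]; simp
    have hcoef : ∀ x, 0 ≤ a x + b x + qs p L x := fun x => by
      linarith [(ha' x).1, (hb' x).1, qs_nonneg hp L x]
    have hsum : ∑ x ∈ L, (a x + b x + qs p L x) * Gf p a b k (L.erase x)
        ≤ (2 * k + (((k+1).choose 2 : ℕ) : ℝ)) * ((h - l) / 3) := by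
      have hq := sum_qs hc L
      rw [hL] at hq
      by_cases hJ2 : ∀ x ∈ L.erase z, a x ≤ b x
      · have g0 := Gf_nonpos hp (fun x => (ha' x).1) (fun x => (hb' x).1) k _ hJ2
        rw [← Finset.add_sum_erase _ _ hz]
        have h1 : (a z + b z + qs p L z) * Gf p a b k (L.erase z) ≤ qs p L z * ((h-l)/3) := by
          have := mul_nonpos_of_nonneg_of_nonpos (hcoef z) g0
          have : 0 ≤ qs p L z * ((h-l)/3) := mul_nonneg (qs_nonneg hp L z) (by linarith)
          linarith
        have h2 : ∑ x ∈ L.erase z, (a x + b x + qs p L x) * Gf p a b k (L.erase x)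
            ≤ ∑ x ∈ L.erase z, (2 + qs p L x) * ((h-l)/3) := by
          apply Finset.sum_le_sum
          intro x hx
          have hx' := Finset.mem_of_mem_erase hx
          apply (mul_le_mul_of_nonneg_left (ih _ (hcard x hx')) (hcoef x)).trans
          apply mul_le_mul_of_nonneg_right _ (by linarith)
          linarith [(ha' x).2.1, (hb' x).2.1]
        rw [← Finset.sum_mul, Finset.sum_add_distrib] at h2
        simp only [Finset.sum_const, hcard z hz, nsmul_eq_mul] at h2
        rw [← Finset.add_sum_erase _ _ hz] at hq
        rw [← hq]
        linarith
      · push Not at hJ2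
        obtain ⟨z2, hz2, hz2ab⟩ := hJ2
        have e1 := hP z (not_le.2 hzab)
        have e2 := hP z2 (not_le.2 hz2ab)
        have h2 : ∑ x ∈ L, (a x + b x + qs p L x) * Gf p a b k (L.erase x)
            ≤ ∑ x ∈ L, (a x + b x + qs p L x) * ((h-l)/3) := by
          apply Finset.sum_le_sum
          intro x hx
          exact mul_le_mul_of_nonneg_left (ih _ (hcard x hx)) (hcoef x)
        apply h2.trans
        rw [← Finset.sum_mul]
        apply mul_le_mul_of_nonneg_right _ (by linarith)
        rw [Finset.sum_add_distrib, hq]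
        have h3 : ∑ x ∈ L, (a x + b x) ≤ 2 * k := by
          rw [← Finset.add_sum_erase _ _ hz, ← Finset.add_sum_erase _ _ hz2, e1, e2]
          have : ∑ x ∈ (L.erase z).erase z2, (a x + b x)
              ≤ ∑ x ∈ (L.erase z).erase z2, (2:ℝ) :=
            Finset.sum_le_sum fun x _ => by linarith [(ha' x).2.1, (hb' x).2.1]
          have hk : 0 < k := by
            rw [← hcard z hz]; exact Finset.card_pos.2 ⟨z2, hz2⟩
          obtain ⟨j, rfl⟩ : ∃ j, k = j + 1 := ⟨k - 1, by omega⟩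
          simp only [Finset.sum_const, Finset.card_erase_of_mem hz2, hcard z hz] at this
          simp at this
          push_cast
          linarith
        linarith
    simp only [Gf]
    have hpos := choose2_pos (k+1)
    rw [inv_mul_le_iff₀ hpos, choose2_succ (k+2), choose2_succ (k+1)]
    rw [choose2_succ k] at hsum
    rw [choose2_succ k]
    push_cast
    linarith

/-! ### Reduction to corners -/

/-- `f` is an affine function of a real variable. -/
def Aff (f : ℝ → ℝ) : Prop := ∃ α β : ℝ, ∀ t, f t = α + β * t

theorem Aff.const (c : ℝ) : Aff fun _ => c := ⟨c, 0, by simp⟩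

theorem Aff.id_add (c : ℝ) : Aff fun t => t + c := ⟨c, 1, fun t => by ring⟩

theorem Aff.add {f g : ℝ → ℝ} (hf : Aff f) (hg : Aff g) : Aff fun t => f t + g t := by
  obtain ⟨α, β, h⟩ := hf
  obtain ⟨α', β', h'⟩ := hg
  exact ⟨α + α', β + β', fun t => by beta_reduce; rw [h, h']; ring⟩

theorem Aff.cmul {f : ℝ → ℝ} (hf : Aff f) (c : ℝ) : Aff fun t => c * f t := by
  obtain ⟨α, β, h⟩ := hf
  exact ⟨c * α, c * β, fun t => by beta_reduce; rw [h]; ring⟩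

theorem Aff.mulc {f : ℝ → ℝ} (hf : Aff f) (c : ℝ) : Aff fun t => f t * c := by
  obtain ⟨α, β, h⟩ := hf
  exact ⟨c * α, c * β, fun t => by beta_reduce; rw [h]; ring⟩

theorem Aff.sum {ι : Type*} (s : Finset ι) {f : ι → ℝ → ℝ} (hf : ∀ i ∈ s, Aff (f i)) :
    Aff fun t => ∑ i ∈ s, f i t := by
  induction s using Finset.induction_on with
  | empty => simpa using Aff.const 0
  | insert i s hi ih =>
    simp only [Finset.sum_insert hi]
    exact (hf i (by simp)).add (ih fun j hj => hf j (by simp [hj]))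

theorem Aff.le {f : ℝ → ℝ} (hf : Aff f) {l h C t : ℝ} (hl : f l ≤ C) (hh : f h ≤ C)
    (h1 : l ≤ t) (h2 : t ≤ h) : f t ≤ C := by
  obtain ⟨α, β, e⟩ := hf
  rw [e] at *
  rcases le_total 0 β with hb | hb
  · nlinarith
  · nlinarith

theorem multi_aff_le (f : (Fin n → ℝ) → ℝ)
    (hf : ∀ a i, Aff fun t => f (Function.update a i t)) {l h C : ℝ}
    (hcor : ∀ a, (∀ x, a x = l ∨ a x = h) → f a ≤ C) (a : Fin n → ℝ)
    (ha : ∀ x, l ≤ a x ∧ a x ≤ h) : f a ≤ C := by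
  suffices H : ∀ (s : Finset (Fin n)) (a : Fin n → ℝ),
      (∀ x ∈ s, l ≤ a x ∧ a x ≤ h) → (∀ x, x ∉ s → a x = l ∨ a x = h) → f a ≤ C from
    H Finset.univ a (fun x _ => ha x) (fun x hx => absurd (Finset.mem_univ x) hx)
  intro s
  induction s using Finset.induction_on with
  | empty => intro a _ h2; exact hcor a fun x => h2 x (by simp)
  | insert i s hi ih =>
    intro a h1 h2
    have key : ∀ t, (t = l ∨ t = h) → f (Function.update a i t) ≤ C := by
      intro t ht
      apply ih
      · intro x hx
        have : x ≠ i := fun e => hi (e ▸ hx)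
        rw [Function.update_of_ne this]
        exact h1 x (by simp [hx])
      · intro x hx
        by_cases e : x = i
        · subst e; simpa using ht
        · rw [Function.update_of_ne e]
          exact h2 x (by simp [hx, e])
    have := (hf a i).le (key l (Or.inl rfl)) (key h (Or.inr rfl)) (h1 i (by simp)).1
      (h1 i (by simp)).2
    simpa using this

theorem Wf_congr {p : Fin n → Fin n → ℝ} {a a' : Fin n → ℝ} (k : ℕ) :
    ∀ L : Finset (Fin n), (∀ x ∈ L, a x = a' x) → Wf p a k L = Wf p a' k L := by
  induction k with
  | zero => intro L _; rfl
  | succ k ih =>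
    intro L hL
    simp only [Wf]
    congr 1
    apply Finset.sum_congr rfl
    intro x hx
    rw [hL x hx, ih _ fun y hy => hL y (Finset.mem_of_mem_erase hy)]

theorem Gf_congr {p : Fin n → Fin n → ℝ} {a a' b : Fin n → ℝ} (k : ℕ) :
    ∀ L : Finset (Fin n), (∀ x ∈ L, a x = a' x) → Gf p a b k L = Gf p a' b k L := by
  induction k with
  | zero => intro L _; rfl
  | succ k ih =>
    intro L hL
    simp only [Gf]
    rw [Wf_congr (k+1) L hL]
    congr 2
    apply Finset.sum_congr rfl
    intro x hx
    rw [hL x hx, ih _ fun y hy => hL y (Finset.mem_of_mem_erase hy)]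

theorem Wf_aff (p : Fin n → Fin n → ℝ) (a : Fin n → ℝ) (i : Fin n) (k : ℕ) :
    ∀ L : Finset (Fin n), Aff fun t => Wf p (Function.update a i t) k L := by
  induction k with
  | zero => intro L; exact Aff.const 1
  | succ k ih =>
    intro L
    simp only [Wf]
    apply Aff.cmul
    apply Aff.sum
    intro x _
    by_cases e : x = i
    · subst e
      simp only [Function.update_self]
      have : ∀ t, Wf p (Function.update a x t) k (L.erase x) = Wf p a k (L.erase x) := by
        intro t
        apply Wf_congr
        intro y hy
        rw [Function.update_of_ne (Finset.ne_of_mem_erase hy)]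
      simp only [this]
      exact (Aff.id_add _).mulc _
    · simp only [Function.update_of_ne e]
      exact (ih _).cmul _

theorem Gf_aff (p : Fin n → Fin n → ℝ) (a b : Fin n → ℝ) (i : Fin n) (k : ℕ) :
    ∀ L : Finset (Fin n), Aff fun t => Gf p (Function.update a i t) b k L := by
  induction k with
  | zero => intro L; exact Aff.const 0
  | succ k ih =>
    intro L
    simp only [Gf]
    apply Aff.cmul
    apply Aff.add
    · apply Aff.sum
      intro x _
      by_cases e : x = i
      · subst e
        simp only [Function.update_self]
        have : ∀ t, Gf p (Function.update a x t) b k (L.erase x) = Gf p a b k (L.erase x) := by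
          intro t
          apply Gf_congr
          intro y hy
          rw [Function.update_of_ne (Finset.ne_of_mem_erase hy)]
        simp only [this, add_assoc]
        exact (Aff.id_add _).mulc _
      · simp only [Function.update_of_ne e]
        exact (ih _).cmul _
    · simp only [sub_eq_add_neg]
      exact (Wf_aff p a i (k+1) L).add (Aff.const _)

theorem Gf_le {p : Fin n → Fin n → ℝ} (hp : ∀ i j, 0 ≤ p i j)
    (hc : ∀ i j, i ≠ j → p i j + p j i = 1)
    {h l : ℝ} (hl : 0 ≤ l) (hlh : l ≤ h) (hs : h + l = 1) {a b : Fin n → ℝ}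
    (ha : ∀ x, l ≤ a x ∧ a x ≤ h) (hb : ∀ x, l ≤ b x ∧ b x ≤ h) (k : ℕ)
    (L : Finset (Fin n)) (hL : L.card = k) : Gf p a b k L ≤ (h - l) / 3 := by
  refine multi_aff_le (fun b => Gf p a b k L) ?_ ?_ b hb
  · intro b i
    simp only [Gf_antisymm p a]
    obtain ⟨α, β, e⟩ := Gf_aff p b a i k L
    exact ⟨-α, -β, fun t => by have := e t; beta_reduce at this ⊢; rw [this]; ring⟩
  · intro b hb
    exact multi_aff_le (fun a => Gf p a b k L) (fun a i => Gf_aff p a b i k L)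
      (fun a ha => Gf_corner hp hc hl hlh hs ha hb k L hL) a ha

/-! ### Recursion for Randomized Death Match on finsets of teams -/

/-- Winning probability of `i` when `K` (with `k + 1` members) is the set of remaining
teams and `q` gives match probabilities. -/
noncomputable def Rf (q : Fin n → Fin n → ℝ) : ℕ → Finset (Fin n) → Fin n → ℝ
  | 0, _, _ => 1
  | k+1, K, i => (((k+2).choose 2 : ℕ) : ℝ)⁻¹ *
      ∑ x ∈ K.erase i, qs q K x * Rf q k (K.erase x) i

theorem qs_insert (q : Fin n → Fin n → ℝ) {u x : Fin n} {L : Finset (Fin n)} (hu : u ∉ L)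
    (hux : u ≠ x) : qs q (insert u L) x = q u x + qs q L x := by
  unfold qs
  rw [Finset.erase_insert_of_ne hux, Finset.sum_insert]
  simp [hu]

theorem Rf_eq_Wf (q : Fin n → Fin n → ℝ) (a : Fin n → ℝ) (u : Fin n) (k : ℕ) :
    ∀ L : Finset (Fin n), u ∉ L → (∀ x ∈ L, a x = q u x) →
      Rf q k (insert u L) u = Wf q a k L := by
  induction k with
  | zero => intro L _ _; rfl
  | succ k ih =>
    intro L hu ha
    simp only [Rf, Wf]
    rw [Finset.erase_insert hu]
    congr 1
    apply Finset.sum_congr rfl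
    intro x hx
    have hux : u ≠ x := fun e => hu (e ▸ hx)
    rw [qs_insert q hu hux, Finset.erase_insert_of_ne hux, ih (L.erase x) (by simp [hu])
      (fun y hy => ha y (Finset.mem_of_mem_erase hy)), ha x hx]

theorem Rf_congr {q q' : Fin n → Fin n → ℝ} (k : ℕ) :
    ∀ (K : Finset (Fin n)) (i : Fin n), (∀ x ∈ K, ∀ y ∈ K, x ≠ y → q x y = q' x y) →
      Rf q k K i = Rf q' k K i := by
  induction k with
  | zero => intro K i _; rfl
  | succ k ih =>
    intro K i hK
    simp only [Rf]
    congr 1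
    apply Finset.sum_congr rfl
    intro x hx
    have hxK := Finset.mem_of_mem_erase hx
    rw [ih (K.erase x) i fun y hy z hz => hK y (Finset.mem_of_mem_erase hy) z
      (Finset.mem_of_mem_erase hz)]
    congr 1
    unfold qs
    apply Finset.sum_congr rfl
    intro y hy
    exact hK y (Finset.mem_of_mem_erase hy) x hxK (Finset.ne_of_mem_erase hy)

theorem gain_eq {q q' : Fin n → Fin n → ℝ} {u v : Fin n} (huv : u ≠ v)
    (hadj : ∀ x y, ¬ ((x = u ∨ x = v) ∧ (y = u ∨ y = v)) → q x y = q' x y)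
    (hc : q u v + q v u = 1) (hc' : q' u v + q' v u = 1) (a b : Fin n → ℝ) (k : ℕ) :
    ∀ L : Finset (Fin n), u ∉ L → v ∉ L → L.card = k → (∀ x ∈ L, a x = q u x) →
      (∀ x ∈ L, b x = q v x) →
      Rf q' (k+1) (insert u (insert v L)) u + Rf q' (k+1) (insert u (insert v L)) v
       - (Rf q (k+1) (insert u (insert v L)) u + Rf q (k+1) (insert u (insert v L)) v)
       = (q' u v - q u v) * Gf q a b k L := by
  -- a common expansion of both sums
  have expand : ∀ (r : Fin n → Fin n → ℝ) (k : ℕ) (L : Finset (Fin n)), u ∉ L → v ∉ L →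
      Rf r (k+1) (insert u (insert v L)) u + Rf r (k+1) (insert u (insert v L)) v
       = (((k+2).choose 2 : ℕ) : ℝ)⁻¹ * (
          (r u v + qs r (insert v L) v) * Rf r k (insert u L) u
          + (r v u + qs r (insert u L) u) * Rf r k (insert v L) v
          + ∑ x ∈ L, (r u x + r v x + qs r L x) *
            (Rf r k (insert u (insert v (L.erase x))) u
              + Rf r k (insert u (insert v (L.erase x))) v)) := by
    intro r k L hu hv
    have hu' : u ∉ insert v L := by simp [hu, huv]
    have hv' : v ∉ insert u L := by simp [hv, huv.symm]
    have comm : insert u (insert v L) = insert v (insert u L) := Finset.insert_comm _ _ _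
    have e1 : (insert u (insert v L)).erase u = insert v L := Finset.erase_insert hu'
    have e2 : (insert u (insert v L)).erase v = insert u L := by
      rw [comm]; exact Finset.erase_insert hv'
    simp only [Rf]
    rw [e1, e2, Finset.sum_insert hv, Finset.sum_insert hu, e1, e2,
      qs_insert r hu' huv]
    have e3 : qs r (insert u (insert v L)) u = r v u + qs r (insert u L) u := by
      rw [comm, qs_insert r hv' huv.symm]
    rw [e3, ← mul_add]
    congr 1
    have e4 : ∀ x ∈ L, qs r (insert u (insert v L)) x = r u x + r v x + qs r L x := by
      intro x hx
      have hux : u ≠ x := fun e => hu (e ▸ hx)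
      have hvx : v ≠ x := fun e => hv (e ▸ hx)
      rw [qs_insert r hu' hux, qs_insert r hv hvx]
      ring
    have e5 : ∀ x ∈ L, (insert u (insert v L)).erase x = insert u (insert v (L.erase x)) := by
      intro x hx
      have hux : u ≠ x := fun e => hu (e ▸ hx)
      have hvx : v ≠ x := fun e => hv (e ▸ hx)
      rw [Finset.erase_insert_of_ne hux, Finset.erase_insert_of_ne hvx]
    have e6 : ∑ x ∈ L, (r u x + r v x + qs r L x) *
            (Rf r k (insert u (insert v (L.erase x))) u
              + Rf r k (insert u (insert v (L.erase x))) v)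
        = ∑ x ∈ L, qs r (insert u (insert v L)) x * Rf r k ((insert u (insert v L)).erase x) u
         + ∑ x ∈ L, qs r (insert u (insert v L)) x *
            Rf r k ((insert u (insert v L)).erase x) v := by
      rw [← Finset.sum_add_distrib]
      apply Finset.sum_congr rfl
      intro x hx
      rw [e4 x hx, e5 x hx]; ring
    rw [e6]; ring
  have out : ∀ (w : Fin n) (M : Finset (Fin n)) (k : ℕ), (w = u ∨ w = v) → u ∉ M → v ∉ M →
      Rf q' k (insert w M) w = Rf q k (insert w M) w := by
    intro w M k hw huM hvM
    apply Rf_congr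
    intro x hx y hy hxy
    symm
    apply hadj
    rintro ⟨h1, h2⟩
    have f : ∀ z ∈ insert w M, (z = u ∨ z = v) → z = w := by
      intro z hz hz'
      rcases Finset.mem_insert.1 hz with h | h
      · exact h
      · rcases hz' with rfl | rfl
        · exact absurd h huM
        · exact absurd h hvM
    exact hxy ((f x hx h1).trans (f y hy h2).symm)
  have qq : ∀ (w : Fin n) (M : Finset (Fin n)), u ∉ M → v ∉ M → 
      qs q' (insert w M) w = qs q (insert w M) w := by
    intro w M huM hvM
    unfold qs
    apply Finset.sum_congr rfl
    intro y hy
    symm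
    apply hadj
    rintro ⟨h1, _⟩
    have hyM : y ∈ M := by
      have := Finset.mem_of_mem_erase hy
      exact (Finset.mem_insert.1 this).resolve_left (Finset.ne_of_mem_erase hy)
    rcases h1 with rfl | rfl
    · exact huM hyM
    · exact hvM hyM
  have qL : ∀ (L : Finset (Fin n)) (x : Fin n), x ∈ L → u ∉ L → v ∉ L →
      q' u x = q u x ∧ q' v x = q v x ∧ qs q' L x = qs q L x := by
    intro L x hx hu hv
    have hx' : ¬ (x = u ∨ x = v) := by
      rintro (rfl | rfl)
      · exact hu hx
      · exact hv hx
    refine ⟨(hadj _ _ fun h => hx' h.2).symm, (hadj _ _ fun h => hx' h.2).symm, ?_⟩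
    unfold qs
    exact Finset.sum_congr rfl fun y _ => (hadj _ _ fun h => hx' h.2).symm
  induction k with
  | zero =>
    intro L hu hv hL ha hb
    rw [expand q' 0 L hu hv, expand q 0 L hu hv, qq v L hu hv, qq u L hu hv]
    have : L = ∅ := Finset.card_eq_zero.1 hL
    subst this
    simp only [Rf, Gf, Finset.sum_empty]
    linear_combination (((0+2).choose 2 : ℕ) : ℝ)⁻¹ * (hc' - hc)
  | succ k ih =>
    intro L hu hv hL ha hb
    rw [expand q' (k+1) L hu hv, expand q (k+1) L hu hv, qq v L hu hv, qq u L hu hv,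
      out u L (k+1) (Or.inl rfl) hu hv, out v L (k+1) (Or.inr rfl) hu hv,
      Rf_eq_Wf q a u (k+1) L hu ha, Rf_eq_Wf q b v (k+1) L hv hb]
    simp only [Gf]
    have hsum : ∑ x ∈ L, (q' u x + q' v x + qs q' L x) *
            (Rf q' (k+1) (insert u (insert v (L.erase x))) u
              + Rf q' (k+1) (insert u (insert v (L.erase x))) v)
        - ∑ x ∈ L, (q u x + q v x + qs q L x) *
            (Rf q (k+1) (insert u (insert v (L.erase x))) u
              + Rf q (k+1) (insert u (insert v (L.erase x))) v)
        = (q' u v - q u v) * ∑ x ∈ L, (a x + b x + qs q L x) * Gf q a b k (L.erase x) := by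
      rw [← Finset.sum_sub_distrib, Finset.mul_sum]
      apply Finset.sum_congr rfl
      intro x hx
      obtain ⟨h1, h2, h3⟩ := qL L x hx hu hv
      have := ih (L.erase x) (by simp [hu]) (by simp [hv])
        (by rw [Finset.card_erase_of_mem hx, hL]; simp)
        (fun y hy => ha y (Finset.mem_of_mem_erase hy))
        (fun y hy => hb y (Finset.mem_of_mem_erase hy))
      rw [h1, h2, h3, ha x hx, hb x hx]
      linear_combination (q u x + q v x + qs q L x) * this
    linear_combination (((k+1+2).choose 2 : ℕ) : ℝ)⁻¹ * (hsum + (hc' - hc) * Wf q b (k+1) L)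

/-! ### Linking with the definition of `RDM` -/

theorem beats_self (o : Outcome n) (i : Fin n) : o.beats i i = false := by
  simp [Outcome.beats]

theorem beats_symm (o : Outcome n) {i j : Fin n} (h : i ≠ j) : o.beats j i = !o.beats i j := by
  rcases lt_or_gt_of_ne h with h | h
  · simp [Outcome.beats, h, not_lt.2 h.le]
  · simp [Outcome.beats, h, not_lt.2 h.le]

/-- 0/1 match matrix of a deterministic tournament. -/
noncomputable def bm (o : Outcome n) (i j : Fin n) : ℝ := if o.beats i j then 1 else 0

/-- The loser of a match. -/
def loser (o : Outcome n) (e : MatchPair n) : Fin n :=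
  if o.beats e.val.1 e.val.2 then e.val.2 else e.val.1

theorem survivors_single (o : Outcome n) (e : MatchPair n) :
    survivors o {e} = Finset.univ.erase (loser o e) := by
  ext i
  have hne : e.val.1 ≠ e.val.2 := ne_of_lt e.2
  have hs := beats_symm o hne
  simp only [survivors, losesIn, loser, Finset.mem_filter, Finset.mem_univ, true_and,
    Finset.mem_singleton, Finset.mem_erase, and_true, exists_eq_left]
  cases hb : o.beats e.val.1 e.val.2 <;> rw [hb] at hs
  · simp only [Bool.not_false] at hs
    constructor
    · rintro h rfl
      exact h (Or.inl ⟨by simp, by simpa using hs⟩)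
    · rintro h (⟨h1, h2⟩ | ⟨h1, h2⟩)
      · exact h (by simp [h1])
      · subst h1; rw [hb] at h2; exact absurd h2 (by simp)
  · simp only [Bool.not_true] at hs
    constructor
    · rintro h rfl
      exact h (Or.inr ⟨by simp, by simpa using hb⟩)
    · rintro h (⟨h1, h2⟩ | ⟨h1, h2⟩)
      · subst h1; rw [hs] at h2; exact absurd h2 (by simp)
      · exact h (by simp [h1])

theorem sum_pairs (f : Fin n → Fin n → ℝ) :
    ∑ e : MatchPair n, (f e.val.1 e.val.2 + f e.val.2 e.val.1)
      = ∑ x : Fin n, ∑ y ∈ Finset.univ.erase x, f y x := by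
  have h1 : ∀ g : Fin n → Fin n → ℝ, ∑ e : MatchPair n, g e.val.1 e.val.2
      = ∑ q : Fin n × Fin n, if q.1 < q.2 then g q.1 q.2 else 0 := by
    intro g
    rw [← Finset.sum_filter]
    exact (Finset.sum_subtype (p := fun q : Fin n × Fin n => q.1 < q.2) _ (by simp)
      (fun q => g q.1 q.2)).symm
  rw [Finset.sum_add_distrib, h1 f, h1 (fun x y => f y x), Fintype.sum_prod_type,
    Fintype.sum_prod_type, Finset.sum_comm, ← Finset.sum_add_distrib]
  apply Finset.sum_congr rfl
  intro x _
  rw [← Finset.sum_add_distrib, ← Finset.add_sum_erase _ _ (Finset.mem_univ x)]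
  simp only [lt_irrefl, if_false, add_zero, zero_add]
  apply Finset.sum_congr rfl
  intro y hy
  rcases lt_or_gt_of_ne (Finset.ne_of_mem_erase hy) with h | h
  · simp [h, not_lt.2 h.le]
  · simp [h, not_lt.2 h.le]

theorem sum_loser (o : Outcome n) (F : Fin n → ℝ) :
    ∑ e : MatchPair n, F (loser o e) = ∑ x, qs (bm o) Finset.univ x * F x := by
  simp only [qs, Finset.sum_mul]
  rw [← sum_pairs (fun y x => bm o y x * F x)]
  apply Finset.sum_congr rfl
  intro e _
  have hne : e.val.1 ≠ e.val.2 := ne_of_lt e.2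
  have hs := beats_symm o hne
  simp only [bm, loser, hs]
  cases o.beats e.val.1 e.val.2 <;> simp

theorem RDMAux_eq (o : Outcome n) (fuel : ℕ) :
    ∀ (m : ℕ) (o' : Outcome (m+1)) (φ : Fin (m+1) ↪ Fin n),
      (∀ i j, o'.beats i j = o.beats (φ i) (φ j)) → m ≤ fuel → ∀ i,
      RDMAux fuel (m+1) o' i = Rf (bm o) m (Finset.univ.map φ) (φ i) := by
  induction fuel with
  | zero =>
    intro m o' φ _ hm i
    obtain rfl : m = 0 := by omega
    simp [RDMAux, Rf]
  | succ fuel ih =>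
    intro m o' φ hφ hm i
    cases m with
    | zero => simp [RDMAux, Rf]
    | succ m =>
      rw [RDMAux, if_neg (by omega)]
      simp only [Rf]
      congr 1
      have key : ∀ e : MatchPair (m+1+1),
          (if h : i ∈ survivors o' {e} then
            RDMAux fuel (survivors o' {e}).card (restrictOutcome o' (survivors o' {e}))
              (((survivors o' {e}).orderIsoOfFin rfl).symm ⟨i, h⟩) else 0)
          = (fun x => if x = i then 0 else
              Rf (bm o) m ((Finset.univ.map φ).erase (φ x)) (φ i)) (loser o' e) := by
        intro e
        have hsv := survivors_single o' e
        by_cases h : loser o' e = i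
        · have : i ∉ survivors o' {e} := by rw [hsv, h]; simp
          simp [h, this]
        · have hi : i ∈ survivors o' {e} := by
            rw [hsv]; simp [Ne.symm h]
          simp only [h, if_false, hi, dif_pos]
          generalize survivors o' {e} = s at *
          have hcard : s.card = m + 1 := by
            rw [hsv, Finset.card_erase_of_mem (Finset.mem_univ _)]; simp
          have gen : ∀ (c : ℕ) (hc : s.card = c) (o2 : Outcome c) (ψ : Fin c ↪ Fin n)
              (j : Fin c), (∀ a b, o2.beats a b = o.beats (ψ a) (ψ b)) →
              RDMAux fuel c o2 j = Rf (bm o) m (Finset.univ.map ψ) (ψ j) := by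
            intro c hc o2 ψ j hψ
            obtain rfl : c = m + 1 := hc.symm.trans hcard
            exact ih m o2 ψ hψ (by omega) j
          have := gen s.card rfl (restrictOutcome o' s)
            ((s.orderEmbOfFin rfl).toEmbedding.trans φ)
            ((s.orderIsoOfFin rfl).symm ⟨i, hi⟩) ?_
          · rw [this]
            congr 1
            · rw [← Finset.map_map]
              have : Finset.map (s.orderEmbOfFin rfl).toEmbedding Finset.univ = s := by
                simp
              rw [this, hsv, Finset.map_erase]
            · simp [← Finset.coe_orderIsoOfFin_apply]
          · intro a b
            have hR : ∀ a b, (restrictOutcome o' s).beats a b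
                = o'.beats (s.orderEmbOfFin rfl a) (s.orderEmbOfFin rfl b) := by
              intro a b
              rcases lt_trichotomy a b with hab | hab | hab
              · rw [Outcome.beats, dif_pos hab]; rfl
              · subst hab; simp [beats_self]
              · have hab' : s.orderEmbOfFin rfl b ≠ s.orderEmbOfFin rfl a := by
                  simpa using hab.ne
                rw [beats_symm o' hab', beats_symm _ hab.ne, Outcome.beats, dif_pos hab]; rfl
            rw [hR, hφ]; rfl
      rw [Finset.sum_congr rfl fun e _ => key e, sum_loser o' (fun x => if x = i then 0 else
        Rf (bm o) m ((Finset.univ.map φ).erase (φ x)) (φ i))]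
      rw [← Finset.map_erase, Finset.sum_map]
      rw [← Finset.add_sum_erase _ _ (Finset.mem_univ i)]
      simp only [if_true, mul_zero, zero_add]
      apply Finset.sum_congr rfl
      intro x hx
      rw [if_neg (Finset.ne_of_mem_erase hx)]
      congr 1
      unfold qs
      rw [← Finset.map_erase, Finset.sum_map]
      apply Finset.sum_congr rfl
      intro y _
      simp [bm, hφ]

theorem RDM_eq {m : ℕ} (o : Outcome (m+1)) (i : Fin (m+1)) :
    RDM (m+1) o i = Rf (bm o) m Finset.univ i := by
  have := RDMAux_eq o (m+1) m o (Function.Embedding.refl _) (fun _ _ => rfl) (by omega) i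
  simpa [RDM] using this

/-! ### Expectations -/

/-- Expectation with respect to the product distribution. -/
noncomputable def Ex (T : ProbTournament n) (f : Outcome n → ℝ) : ℝ :=
  ∑ o : Outcome n, T.prob o * f o

theorem Ex_indep (T : ProbTournament n) (e : MatchPair n) (f : Outcome n → ℝ)
    (hf : ∀ o b, f (Function.update o e b) = f o) (b : Bool) :
    Ex T (fun o => (if o e = b then 1 else 0) * f o)
      = (if b then T.p e.val.1 e.val.2 else T.p e.val.2 e.val.1) * Ex T f := by
  set wt : MatchPair n → Bool → ℝ := fun e b =>
    if b then T.p e.val.1 e.val.2 else T.p e.val.2 e.val.1 with hwt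
  set rest : Outcome n → ℝ := fun o => ∏ e' ∈ Finset.univ.erase e, wt e' (o e') with hrest
  have hprob : ∀ o, T.prob o = wt e (o e) * rest o := by
    intro o
    rw [hrest]
    exact (Finset.mul_prod_erase Finset.univ (fun e' => wt e' (o e')) (Finset.mem_univ e)).symm
  have hrest' : ∀ o b, rest (Function.update o e b) = rest o := by
    intro o b
    apply Finset.prod_congr rfl
    intro e' he'
    rw [Function.update_of_ne (Finset.ne_of_mem_erase he')]
  let Q : Bool → ℝ := fun b => ∑ o : Outcome n, if o e = b then rest o * f o else 0
  have hEx : ∀ b, Ex T (fun o => (if o e = b then 1 else 0) * f o) = wt e b * Q b := by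
    intro b
    simp only [Ex, Q, Finset.mul_sum]
    apply Finset.sum_congr rfl
    intro o _
    rw [hprob]
    by_cases h : o e = b
    · simp [h, mul_assoc]
    · simp [h]
  have hQ : ∀ b, Q b = Q (!b) := by
    intro b
    simp only [Q]
    have hinv : Function.Involutive (fun o : Outcome n => Function.update o e (!o e)) := by
      intro o; simp
    refine Fintype.sum_equiv hinv.toPerm _ _ ?_
    intro o
    change _ = if (Function.update o e (!o e)) e = !b then
      rest (Function.update o e (!o e)) * f (Function.update o e (!o e)) else 0
    rw [hrest', hf, Function.update_self]
    cases o e <;> cases b <;> simp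
  have htot : Ex T f = wt e b * Q b + wt e (!b) * Q (!b) := by
    rw [← hEx, ← hEx]
    simp only [Ex, ← Finset.sum_add_distrib]
    apply Finset.sum_congr rfl
    intro o _
    cases o e <;> cases b <;> simp
  have hw : wt e b + wt e (!b) = 1 := by
    have := T.compl e.val.1 e.val.2 (ne_of_lt e.2)
    cases b <;> simp [hwt] <;> linarith
  have hf2 : Ex T f = Q b := by
    rw [htot, ← hQ, ← add_mul, hw, one_mul]
  rw [hEx, hf2]

theorem Ex_sum {ι : Type*} (T : ProbTournament n) (s : Finset ι) (f : ι → Outcome n → ℝ) :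
    Ex T (fun o => ∑ i ∈ s, f i o) = ∑ i ∈ s, Ex T (f i) := by
  simp only [Ex, Finset.mul_sum]
  exact Finset.sum_comm

theorem Ex_cmul (T : ProbTournament n) (c : ℝ) (f : Outcome n → ℝ) :
    Ex T (fun o => c * f o) = c * Ex T f := by
  simp only [Ex, Finset.mul_sum]
  exact Finset.sum_congr rfl fun o _ => by ring

theorem Ex_one (T : ProbTournament n) : Ex T (fun _ => 1) = 1 := by
  simp only [Ex, mul_one, ProbTournament.prob]
  have := (Finset.prod_univ_sum (fun _ : MatchPair n => (Finset.univ : Finset Bool))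
    (fun e b => if b then T.p e.val.1 e.val.2 else T.p e.val.2 e.val.1)).symm
  rw [Fintype.piFinset_univ] at this
  rw [this]
  apply Finset.prod_eq_one
  intro e _
  have := T.compl e.val.1 e.val.2 (ne_of_lt e.2)
  simpa using this

theorem Ex_beats (T : ProbTournament n) {y x : Fin n} (hyx : y ≠ x) (f : Outcome n → ℝ)
    (hf : ∀ (e : MatchPair n) o b, (e.val.1 = x ∨ e.val.2 = x) →
      f (Function.update o e b) = f o) :
    Ex T (fun o => bm o y x * f o) = T.p y x * Ex T f := by
  rcases lt_or_gt_of_ne hyx with h | h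
  · have := Ex_indep T ⟨(y, x), h⟩ f (fun o b => hf _ o b (Or.inr rfl)) true
    simp only [if_true] at this
    rw [← this]
    congr 1; ext o
    simp [bm, Outcome.beats, h]
  · have := Ex_indep T ⟨(x, y), h⟩ f (fun o b => hf _ o b (Or.inl rfl)) false
    simp only [Bool.false_eq_true, if_false] at this
    rw [← this]
    congr 1; ext o
    simp [bm, Outcome.beats, h, not_lt.2 h.le]

theorem Rf_update (o : Outcome n) (e : MatchPair n) (b : Bool) (k : ℕ) (K : Finset (Fin n))
    (i x : Fin n) (hx : x ∉ K) (he : e.val.1 = x ∨ e.val.2 = x) :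
    Rf (bm (Function.update o e b)) k K i = Rf (bm o) k K i := by
  apply Rf_congr
  intro y hy z hz _
  have hy' : y ≠ x := fun h => hx (h ▸ hy)
  have hz' : z ≠ x := fun h => hx (h ▸ hz)
  have ne1 : ∀ (s t : Fin n) (h : s < t), s ≠ x → t ≠ x →
      (⟨(s, t), h⟩ : MatchPair n) ≠ e := by
    rintro s t h hs ht rfl
    rcases he with h | h
    · exact hs h
    · exact ht h
  simp only [bm, Outcome.beats]
  split_ifs <;> simp_all [Function.update_of_ne]

theorem Ex_Rf (T : ProbTournament n) (k : ℕ) :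
    ∀ (K : Finset (Fin n)) (i : Fin n), Ex T (fun o => Rf (bm o) k K i) = Rf T.p k K i := by
  induction k with
  | zero => intro K i; simp only [Rf]; exact Ex_one T
  | succ k ih =>
    intro K i
    simp only [Rf, Ex_cmul, Ex_sum]
    congr 1
    apply Finset.sum_congr rfl
    intro x hx
    simp only [qs, Finset.sum_mul, Ex_sum]
    apply Finset.sum_congr rfl
    intro y hy
    rw [Ex_beats T (Finset.ne_of_mem_erase hy), ih]
    intro e o b he
    exact Rf_update o e b k _ i x (by simp) he

theorem rP_eq {m : ℕ} (T : ProbTournament (m+1)) (i : Fin (m+1)) :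
    rP RDM T i = Rf T.p m Finset.univ i := by
  rw [← Ex_Rf]
  simp only [rP, Ex, RDM_eq]

/-! ### Main bound -/

theorem gain_formula {k : ℕ} (T T' : ProbTournament (k+2)) (u v : Fin (k+2)) (huv : u ≠ v)
    (hadj : Adjacent {u, v} T T') (a b : Fin (k+2) → ℝ)
    (ha : ∀ x, x ≠ u → x ≠ v → a x = T.p u x) (hb : ∀ x, x ≠ u → x ≠ v → b x = T.p v x) :
    rPS RDM T' {u, v} - rPS RDM T {u, v}
      = (T'.p u v - T.p u v) * Gf T.p a b k ((Finset.univ.erase u).erase v) := by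
  have hv : v ∈ Finset.univ.erase u := by simp [huv.symm]
  have huniv : (Finset.univ : Finset (Fin (k+2)))
      = insert u (insert v ((Finset.univ.erase u).erase v)) := by
    rw [Finset.insert_erase hv, Finset.insert_erase (Finset.mem_univ _)]
  simp only [rPS, Finset.sum_pair huv, rP_eq]
  rw [← gain_eq huv (q := T.p) (q' := T'.p) ?_ (T.compl _ _ huv) (T'.compl _ _ huv) a b k
    ((Finset.univ.erase u).erase v) (by simp) (by simp) ?_ ?_ ?_, ← huniv]
  · intro x y h
    apply hadj
    simpa using h
  · rw [Finset.card_erase_of_mem hv, Finset.card_erase_of_mem (Finset.mem_univ _)]; simp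
  · intro x hx; simp at hx; exact ha x hx.2 hx.1
  · intro x hx; simp at hx; exact hb x hx.2 hx.1

theorem main_bound (ε : ℝ) (hε : ε ∈ Set.Icc (0 : ℝ) (1/2)) (n : ℕ) (T T' : ProbTournament n)
    (u v : Fin n) (huv : u ≠ v) (hT : WeaklyBounded ε n T) (hadj : Adjacent {u, v} T T') :
    rPS RDM T' {u, v} - rPS RDM T {u, v} ≤ ε/3 + 2*ε^2/3 := by
  obtain ⟨k, rfl⟩ : ∃ k, n = k + 2 := by
    have h1 := u.2
    have h2 := v.2
    have h3 : (u : ℕ) ≠ v := fun h => huv (Fin.ext h)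
    exact ⟨n - 2, by omega⟩
  obtain ⟨e0, e1⟩ := hε
  have half : (1/2 : ℝ) ∈ Set.Icc (1/2 - ε) (1/2 + ε) := ⟨by linarith, by linarith⟩
  set a : Fin (k+2) → ℝ := fun x => if u = x then 1/2 else T.p u x with ha
  set b : Fin (k+2) → ℝ := fun x => if v = x then 1/2 else T.p v x with hb
  have ha' : ∀ x, a x ∈ Set.Icc (1/2 - ε) (1/2 + ε) := fun x => by
    simp only [ha]; split_ifs with h
    · exact half
    · exact hT _ _ h
  have hb' : ∀ x, b x ∈ Set.Icc (1/2 - ε) (1/2 + ε) := fun x => by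
    simp only [hb]; split_ifs with h
    · exact half
    · exact hT _ _ h
  rw [gain_formula T T' u v huv hadj a b (fun x h _ => if_neg h.symm)
    (fun x _ h => if_neg h.symm)]
  have hv : v ∈ (Finset.univ.erase u : Finset (Fin (k+2))) := by simp [huv.symm]
  have hcard : ((Finset.univ.erase u).erase v : Finset (Fin (k+2))).card = k := by
    rw [Finset.card_erase_of_mem hv, Finset.card_erase_of_mem (Finset.mem_univ _)]; simp
  have hp : ∀ i j, 0 ≤ T.p i j := fun i j => (T.mem_Icc i j).1
  have g1 := Gf_le hp T.compl (h := 1/2 + ε) (l := 1/2 - ε) (by linarith) (by linarith)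
    (by ring) ha' hb' k _ hcard
  have g2 := Gf_le hp T.compl (h := 1/2 + ε) (l := 1/2 - ε) (by linarith) (by linarith)
    (by ring) hb' ha' k _ hcard
  rw [Gf_antisymm] at g2
  have d1 := (T'.mem_Icc u v).1
  have d2 := (T'.mem_Icc u v).2
  obtain ⟨d3, d4⟩ := hT u v huv
  generalize Gf T.p a b k ((Finset.univ.erase u).erase v) = g at *
  have q1 : |T'.p u v - T.p u v| ≤ 1/2 + ε := abs_le.2 ⟨by linarith, by linarith⟩
  have q2 : |g| ≤ 2 * ε / 3 := abs_le.2 ⟨by linarith, by linarith⟩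
  calc _ ≤ |(T'.p u v - T.p u v) * g| := le_abs_self _
    _ = |T'.p u v - T.p u v| * |g| := abs_mul _ _
    _ ≤ (1/2 + ε) * (2 * ε / 3) := mul_le_mul q1 q2 (abs_nonneg _) (by linarith)
    _ = _ := by ring

theorem prob_congr {T T' : ProbTournament n} (h : ∀ i j, i ≠ j → T.p i j = T'.p i j)
    (o : Outcome n) : T.prob o = T'.prob o := by
  unfold ProbTournament.prob
  apply Finset.prod_congr rfl
  intro e _
  rw [h _ _ (ne_of_lt e.2), h _ _ (ne_of_gt e.2)]

theorem rPS_congr {T T' : ProbTournament n} (h : ∀ i j, i ≠ j → T.p i j = T'.p i j)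
    (r : ∀ n : ℕ, Outcome n → Fin n → ℝ) (S : Finset (Fin n)) : rPS r T S = rPS r T' S := by
  simp only [rPS, rP, prob_congr h]

/-- Three-team tournament with match probabilities `x` (0 vs 1), `y` (0 vs 2), `z` (1 vs 2). -/
noncomputable def tri (x y z : ℝ) (hx : x ∈ Set.Icc (0:ℝ) 1) (hy : y ∈ Set.Icc (0:ℝ) 1)
    (hz : z ∈ Set.Icc (0:ℝ) 1) : ProbTournament 3 where
  p := ![![1/2, x, y], ![1 - x, 1/2, z], ![1 - y, 1 - z, 1/2]]
  mem_Icc := by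
    obtain ⟨h1, h2⟩ := hx
    obtain ⟨h3, h4⟩ := hy
    obtain ⟨h5, h6⟩ := hz
    intro i j
    fin_cases i <;> fin_cases j <;> simp <;> (try constructor) <;> (try linarith)
  compl := by
    intro i j hij
    fin_cases i <;> fin_cases j <;> simp at hij ⊢

theorem attained (ε : ℝ) (hε : ε ∈ Set.Icc (0 : ℝ) (1/2)) :
    ∃ T T' : ProbTournament 3, WeaklyBounded ε 3 T ∧ Adjacent {0, 1} T T' ∧
      ε/3 + 2*ε^2/3 = rPS RDM T' {0, 1} - rPS RDM T {0, 1} := by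
  obtain ⟨e0, e1⟩ := hε
  have hh : 1/2 + ε ∈ Set.Icc (0:ℝ) 1 := ⟨by linarith, by linarith⟩
  have hl : 1/2 - ε ∈ Set.Icc (0:ℝ) 1 := ⟨by linarith, by linarith⟩
  refine ⟨tri (1/2 - ε) (1/2 + ε) (1/2 - ε) hl hh hl,
    tri 1 (1/2 + ε) (1/2 - ε) ⟨by norm_num, by norm_num⟩ hh hl, ?_, ?_, ?_⟩
  · intro i j hij
    fin_cases i <;> fin_cases j <;> simp [tri] at hij ⊢ <;> (try constructor) <;> linarith
  · intro i j hij
    fin_cases i <;> fin_cases j <;> simp [tri] at hij ⊢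
  · rw [gain_formula (k := 1) _ _ 0 1 (by decide) ?_ (fun _ => 1/2 + ε) (fun _ => 1/2 - ε)]
    · have : ((Finset.univ.erase 0).erase 1 : Finset (Fin 3)) = {2} := by decide
      rw [this]
      simp [Gf, Wf, qs, tri]
      norm_num [Nat.choose]
      ring
    · intro x h0 h1
      fin_cases x <;> simp [tri] at h0 h1 ⊢
    · intro x h0 h1
      fin_cases x <;> simp [tri] at h0 h1 ⊢
    · intro i j hij
      fin_cases i <;> fin_cases j <;> simp [tri] at hij ⊢

end RDMProof

/-! ## Statement -/

theorem stmt10 (ε : ℝ) (hε : ε ∈ Set.Icc (0 : ℝ) (1/2)) :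
    (∀ (n : ℕ) (T T' : ProbTournament n) (u v : Fin n), u ≠ v →
      WeaklyBounded ε n T → Adjacent {u, v} T T' →
      rPS RDM T' {u, v} - rPS RDM T {u, v} ≤ ε/3 + 2*ε^2/3)
    ∧ alph RDM 2 (WeaklyBounded ε) = ε/3 + 2*ε^2/3 := by
  refine ⟨fun n T T' u v huv hT hadj => RDMProof.main_bound ε hε n T T' u v huv hT hadj, ?_⟩
  have hpos : 0 ≤ ε/3 + 2*ε^2/3 := by
    have := hε.1
    positivity
  apply IsGreatest.csSup_eq
  constructor
  · obtain ⟨T, T', h1, h2, h3⟩ := RDMProof.attained ε hε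
    exact ⟨3, T, T', {0, 1}, h1, Finset.card_le_two, h2, h3⟩
  · rintro x ⟨n, T, T', S, hT, hS, hadj, rfl⟩
    rcases Nat.lt_or_ge S.card 2 with h | h
    · have : rPS RDM T S = rPS RDM T' S := by
        apply RDMProof.rPS_congr
        intro i j hij
        apply hadj
        rintro ⟨hi, hj⟩
        exact hij (Finset.card_le_one.1 (by omega) i hi j hj)
      rw [this, sub_self]
      exact hpos
    · obtain ⟨u, v, huv, rfl⟩ := Finset.card_eq_two.1 (le_antisymm hS h)
      exact RDMProof.main_bound ε hε n T T' u v huv hT hadj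
end
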